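/- arXiv:1603.01697 — 2 statements merged into one kernel-verified Lean document; each statement's English description precedes it below -/
import Mathlib

section
/- For every even integer n ≥ 4, the diagonal Ramsey number of the 4-uniform loose cycle satisfies 3n + ⌊(n−1)/2⌋ ≤ R(C^4_n, C^4_n) ≤ 3n + ⌊(n−1)/2⌋ + 1. -/
/-- A copy of the `k`-uniform loose path with `n` edges, all of color `b`
(`true` = red, `false` = blue), in the coloring `col` of the `k`-subsets of `V`.
The path is given by an injective listing `f 0, f 1, …, f (n*(k-1))` of its
vertices, with `i`-th edge `{f (i*(k-1)), …, f (i*(k-1)+k-1)}`. -/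
def HasLoosePath {V : Type*} [DecidableEq V] (k n : ℕ) (col : Finset V → Bool)
    (b : Bool) : Prop :=
  ∃ f : ℕ → V, Set.InjOn f (Set.Iio (n * (k - 1) + 1)) ∧
    ∀ i < n, col ((Finset.range k).image fun j => f (i * (k - 1) + j)) = b

/-- A copy of the `k`-uniform loose cycle with `n` edges, all of color `b`
(`true` = red, `false` = blue), in the coloring `col` of the `k`-subsets of `V`.
The cycle is given by an injective listing `f 0, …, f (n*(k-1) - 1)` of its
vertices, with `i`-th edge `{f (i*(k-1) % (n*(k-1))), …, f ((i*(k-1)+k-1) % (n*(k-1)))}`. -/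
def HasLooseCycle {V : Type*} [DecidableEq V] (k n : ℕ) (col : Finset V → Bool)
    (b : Bool) : Prop :=
  ∃ f : ℕ → V, Set.InjOn f (Set.Iio (n * (k - 1))) ∧
    ∀ i < n, col ((Finset.range k).image fun j => f ((i * (k - 1) + j) % (n * (k - 1)))) = b

/-- `R(P^k_n, P^k_m)`: the least positive `N` such that every red-blue coloring of the
`k`-subsets of an `N`-set contains a red `P^k_n` or a blue `P^k_m`. -/
noncomputable def RamseyPP (k n m : ℕ) : ℕ :=
  sInf {N | 0 < N ∧ ∀ col : Finset (Fin N) → Bool,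
    HasLoosePath k n col true ∨ HasLoosePath k m col false}

/-- `R(P^k_n, C^k_m)`. -/
noncomputable def RamseyPC (k n m : ℕ) : ℕ :=
  sInf {N | 0 < N ∧ ∀ col : Finset (Fin N) → Bool,
    HasLoosePath k n col true ∨ HasLooseCycle k m col false}

/-- `R(C^k_n, P^k_m)`. -/
noncomputable def RamseyCP (k n m : ℕ) : ℕ :=
  sInf {N | 0 < N ∧ ∀ col : Finset (Fin N) → Bool,
    HasLooseCycle k n col true ∨ HasLoosePath k m col false}

/-- `R(C^k_n, C^k_m)`. -/
noncomputable def RamseyCC (k n m : ℕ) : ℕ :=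
  sInf {N | 0 < N ∧ ∀ col : Finset (Fin N) → Bool,
    HasLooseCycle k n col true ∨ HasLooseCycle k m col false}

/-- Lower bound: the coloring "red iff the edge avoids the first m - 1 vertices". -/
theorem lower_aux (m N : ℕ) (hm : 2 ≤ m) (hN0 : 0 < N)
    (h : ∀ col : Finset (Fin N) → Bool,
      HasLooseCycle 4 (2 * m) col true ∨ HasLooseCycle 4 (2 * m) col false) :
    7 * m - 1 ≤ N := by
  by_contra hlt
  push Not at hlt
  rcases h (fun e => decide (∀ x ∈ e, m - 1 ≤ x.val)) with ⟨f, hf, hc⟩ | ⟨f, hf, hc⟩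
  · have h1 : ∀ k < 6 * m, m - 1 ≤ (f k).val := by
      intro k hk
      have := hc (k / 3) (by omega)
      simp only [decide_eq_true_eq] at this
      apply this
      rw [Finset.mem_image]
      refine ⟨k % 3, by rw [Finset.mem_range]; omega, ?_⟩
      congr 1
      rw [Nat.mod_eq_of_lt] <;> omega
    have h2 : (Finset.range (6 * m)).card ≤ (Finset.Ico (m - 1) N).card := by
      apply Finset.card_le_card_of_injOn (fun k => (f k).val)
      · intro k hk
        simp only [Finset.coe_range, Set.mem_Iio] at hk
        simp only [Finset.coe_Ico, Set.mem_Ico]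
        exact ⟨h1 k hk, (f k).isLt⟩
      · intro a ha b hb hab
        simp only [Finset.coe_range, Set.mem_Iio] at ha hb
        exact hf (by simp only [Set.mem_Iio]; omega) (by simp only [Set.mem_Iio]; omega)
          (Fin.ext hab)
    simp only [Finset.card_range, Nat.card_Ico] at h2
    omega
  · have h1 : ∀ i : ℕ, ∃ j, i < 2 * m →
        j < 4 ∧ (f ((i * 3 + j) % (6 * m))).val < m - 1 := by
      intro i
      by_cases hi : i < 2 * m
      · have := hc i hi
        simp only [decide_eq_false_iff_not, not_forall] at this
        obtain ⟨x, hx, hx2⟩ := this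
        rw [Finset.mem_image] at hx
        obtain ⟨j, hj, rfl⟩ := hx
        rw [Finset.mem_range] at hj
        refine ⟨j, fun _ => ⟨hj, ?_⟩⟩
        have e : 2 * m * (4 - 1) = 6 * m := by omega
        rw [e] at hx2
        simp at hx2
        omega
      · exact ⟨0, fun hh => absurd hh hi⟩
    choose J hJ using h1
    have hcard : (Finset.range (2 * m)).card ≤
        2 * (Finset.range (m - 1)).card := by
      apply Finset.card_le_mul_card_image_of_maps_to
        (f := fun i => (f ((i * 3 + J i) % (6 * m))).val)
      · intro i hi
        rw [Finset.mem_range] at hi ⊢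
        exact (hJ i hi).2
      · intro b hb
        by_contra hcon
        push Not at hcon
        rw [Finset.two_lt_card] at hcon
        obtain ⟨a, ha, b', hb', c, hc', hab, hac, hbc⟩ := hcon
        simp only [Finset.mem_filter, Finset.mem_range] at ha hb' hc'
        have key : ∀ i i' : ℕ, i < 2 * m → i' < 2 * m →
            (f ((i * 3 + J i) % (6 * m))).val = b →
            (f ((i' * 3 + J i') % (6 * m))).val = b →
            (i * 3 + J i) % (6 * m) = (i' * 3 + J i') % (6 * m) := by
          intro i i' _ _ e1 e2
          have e : 2 * m * (4 - 1) = 6 * m := by omega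
          apply hf
          · simp only [Set.mem_Iio]; rw [e]; exact Nat.mod_lt _ (by omega)
          · simp only [Set.mem_Iio]; rw [e]; exact Nat.mod_lt _ (by omega)
          · exact Fin.ext (e1.trans e2.symm)
        have k1 := key a b' ha.1 hb'.1 ha.2 hb'.2
        have k2 := key a c ha.1 hc'.1 ha.2 hc'.2
        have ja := (hJ a ha.1).1
        have jb := (hJ b' hb'.1).1
        have jc := (hJ c hc'.1).1
        have mm : ∀ i j : ℕ, i < 2 * m → j < 4 →
            ((i * 3 + j) % (6 * m) = i * 3 + j ∧ i * 3 + j < 6 * m) ∨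
            ((i * 3 + j) % (6 * m) = 0 ∧ i * 3 + j = 6 * m) := by
          intro i j hi hj
          rcases Nat.lt_or_ge (i * 3 + j) (6 * m) with hh | hh
          · exact Or.inl ⟨Nat.mod_eq_of_lt hh, hh⟩
          · have : i * 3 + j = 6 * m := by omega
            exact Or.inr ⟨by rw [this, Nat.mod_self], this⟩
        have m1 := mm a (J a) ha.1 ja
        have m2 := mm b' (J b') hb'.1 jb
        have m3 := mm c (J c) hc'.1 jc
        omega
    simp only [Finset.card_range] at hcard
    omega

inductive LPath {V : Type*} [DecidableEq V] (col : Finset V → Bool) (b : Bool) :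
    V → V → Finset V → ℕ → Prop
  | nil (x : V) : LPath col b x x ∅ 0
  | cons {x p q y z : V} {S : Finset V} {n : ℕ} : LPath col b y z S n →
      x ≠ p → x ≠ q → p ≠ q → x ∉ S → p ∉ S → q ∉ S → col {x, p, q, y} = b →
      LPath col b x z (insert x (insert p (insert q S))) (n + 1)

def Cyc {V : Type*} [DecidableEq V] (col : Finset V → Bool) (b : Bool) (n : ℕ) : Prop :=
  ∃ x S, LPath col b x x S n

namespace LPath

variable {V : Type*} [DecidableEq V] {col : Finset V → Bool} {b : Bool}

theorem append {x y z : V} {S T : Finset V} {n m : ℕ} (h1 : LPath col b x y S n)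
    (h2 : LPath col b y z T m) (hd : Disjoint S T) : LPath col b x z (S ∪ T) (n + m) := by
  induction h1 with
  | nil x => simpa using h2
  | @cons x p q y z S n h a1 a2 a3 a4 a5 a6 a7 ih =>
    simp only [Finset.disjoint_insert_left] at hd
    have := LPath.cons (ih h2 hd.2.2.2) a1 a2 a3 (by simp [a4, hd.1]) (by simp [a5, hd.2.1])
      (by simp [a6, hd.2.2.1]) a7
    have e : n + 1 + m = n + m + 1 := by omega
    rw [e]
    simpa [Finset.insert_union] using this

theorem append' {x y z : V} {S T U : Finset V} {n m k : ℕ} (h1 : LPath col b x y S n)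
    (h2 : LPath col b y z T m) (hd : Disjoint S T) (hU : S ∪ T = U) (hk : n + m = k) :
    LPath col b x z U k := by
  subst hU hk
  exact h1.append h2 hd

theorem inv {x z : V} {S : Finset V} {n : ℕ} (h : LPath col b x z S (n + 1)) :
    ∃ p q y T, LPath col b y z T n ∧ x ≠ p ∧ x ≠ q ∧ p ≠ q ∧ x ∉ T ∧ p ∉ T ∧ q ∉ T ∧
      col {x, p, q, y} = b ∧ S = insert x (insert p (insert q T)) := by
  cases h with
  | cons h a1 a2 a3 a4 a5 a6 a7 => exact ⟨_, _, _, _, h, a1, a2, a3, a4, a5, a6, a7, rfl⟩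

theorem mem_start {x z : V} {S : Finset V} {n : ℕ} (h : LPath col b x z S n) (hn : n ≠ 0) :
    x ∈ S := by
  cases h with
  | nil => exact absurd rfl hn
  | cons => simp

theorem card {x z : V} {S : Finset V} {n : ℕ} (h : LPath col b x z S n) : S.card = 3 * n := by
  induction h with
  | nil => simp
  | @cons x p q y z S n h a1 a2 a3 a4 a5 a6 a7 ih =>
    rw [Finset.card_insert_of_notMem (by simp [*]), Finset.card_insert_of_notMem (by simp [*]),
      Finset.card_insert_of_notMem a6, ih]
    ring

theorem edge {F : Finset V} (hF : F.card = 4) {x y : V} (hx : x ∈ F) (hy : y ∈ F) (hxy : x ≠ y)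
    (hc : col F = b) : LPath col b x y (F.erase y) 1 := by
  have h2 : ((F.erase y).erase x).card = 2 := by
    rw [Finset.card_erase_of_mem (by simp [hxy, hx]), Finset.card_erase_of_mem hy, hF]
  obtain ⟨p, q, hpq, he⟩ := Finset.card_eq_two.1 h2
  have e1 : F.erase y = insert x {p, q} := by
    rw [← he, Finset.insert_erase (by simp [hxy, hx])]
  have hx' : x ∉ ({p, q} : Finset V) := by rw [← he]; simp
  have e2 : F = {x, p, q, y} := by
    rw [← Finset.insert_erase hy, e1]; ext; simp; tauto
  have := LPath.cons (col := col) (b := b) (x := x) (p := p) (q := q) (LPath.nil y)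
    (by rintro rfl; simp at hx') (by rintro rfl; simp at hx') hpq (by simp) (by simp) (by simp)
    (by rw [← e2, hc])
  rw [e1]
  simpa using this

theorem edge' {x p q y : V} (h1 : x ≠ p) (h2 : x ≠ q) (h3 : p ≠ q)
    (hc : col {x, p, q, y} = b) : LPath col b x y {x, p, q} 1 := by
  simpa using LPath.cons (LPath.nil y) h1 h2 h3 (by simp) (by simp) (by simp) hc

theorem rotate {x : V} {S : Finset V} {n : ℕ} (h : LPath col b x x S (n + 1)) :
    ∃ p q y T, LPath col b y x T n ∧ x ≠ p ∧ x ≠ q ∧ p ≠ q ∧ x ∉ T ∧ p ∉ T ∧ q ∉ T ∧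
      col {x, p, q, y} = b ∧ S = insert x (insert p (insert q T)) ∧
      LPath col b y y S (n + 1) := by
  obtain ⟨p, q, y, T, h', a1, a2, a3, a4, a5, a6, a7, rfl⟩ := h.inv
  refine ⟨p, q, y, T, h', a1, a2, a3, a4, a5, a6, a7, rfl, ?_⟩
  refine h'.append' (edge' a1 a2 a3 a7) (by simp [*]) (by ext; simp) rfl

theorem toFun {x z : V} {S : Finset V} {n : ℕ} (h : LPath col b x z S n) :
    ∃ f : ℕ → V, (∀ i < 3 * n, f i ∈ S) ∧ Set.InjOn f (Set.Iio (3 * n)) ∧ f 0 = x ∧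
      f (3 * n) = z ∧
      ∀ i < n, col ((Finset.range 4).image fun j => f (3 * i + j)) = b := by
  induction h with
  | nil x => exact ⟨fun _ => x, by simp, by simp, rfl, rfl, by simp⟩
  | @cons x p q y z S n h a1 a2 a3 a4 a5 a6 a7 ih =>
    obtain ⟨f, h1, h2, h3, h4, h5⟩ := ih
    let g : ℕ → V := fun i => match i with
      | 0 => x
      | 1 => p
      | 2 => q
      | j + 3 => f j
    have g3 : ∀ j, g (j + 3) = f j := fun j => rfl
    refine ⟨g, ?_, ?_, rfl, ?_, ?_⟩
    · intro i hi
      match i with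
      | 0 => simp [g]
      | 1 => simp [g]
      | 2 => simp [g]
      | j + 3 =>
        have := h1 j (by omega)
        simp [g3, this]
    · intro i hi j hj hij
      simp only [Set.mem_Iio] at hi hj
      match i, j with
      | 0, 0 => rfl
      | 1, 1 => rfl
      | 2, 2 => rfl
      | 0, 1 => exact absurd hij a1
      | 0, 2 => exact absurd hij a2
      | 1, 2 => exact absurd hij a3
      | 1, 0 => exact absurd hij.symm a1
      | 2, 0 => exact absurd hij.symm a2
      | 2, 1 => exact absurd hij.symm a3
      | 0, j + 3 => exact absurd (by rw [show x = f j from hij]; exact h1 j (by omega)) a4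
      | 1, j + 3 => exact absurd (by rw [show p = f j from hij]; exact h1 j (by omega)) a5
      | 2, j + 3 => exact absurd (by rw [show q = f j from hij]; exact h1 j (by omega)) a6
      | j + 3, 0 => exact absurd (by rw [← show f j = x from hij]; exact h1 j (by omega)) a4
      | j + 3, 1 => exact absurd (by rw [← show f j = p from hij]; exact h1 j (by omega)) a5
      | j + 3, 2 => exact absurd (by rw [← show f j = q from hij]; exact h1 j (by omega)) a6
      | i + 3, j + 3 =>
        have := h2 (show i ∈ Set.Iio (3 * n) by simp; omega) (show j ∈ Set.Iio (3 * n) by simp; omega) hij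
        omega
    · rw [show 3 * (n + 1) = 3 * n + 3 by ring, g3, h4]
    · intro i hi
      match i with
      | 0 =>
        rw [← a7]
        congr 1
        ext; simp [Finset.range_add_one, g, h3]; tauto
      | k + 1 =>
        rw [← h5 k (by omega)]
        congr 1

end LPath

theorem Cyc.toHas {V : Type*} [DecidableEq V] {col : Finset V → Bool} {b : Bool} {n : ℕ}
    (h : Cyc col b n) : HasLooseCycle 4 n col b := by
  obtain ⟨x, S, h⟩ := h
  obtain ⟨f, h1, h2, h3, h4, h5⟩ := h.toFun
  refine ⟨f, ?_, ?_⟩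
  · rw [show n * (4 - 1) = 3 * n by omega]; exact h2
  · intro i hi
    rw [← h5 i hi]
    congr 1
    refine Finset.image_congr ?_
    intro j hj
    simp only [Finset.coe_range, Set.mem_Iio] at hj
    show f ((i * 3 + j) % (n * 3)) = f (3 * i + j)
    by_cases hh : i * 3 + j < n * 3
    · rw [Nat.mod_eq_of_lt hh]; congr 1; ring
    · have e : 3 * i + j = 3 * n := by omega
      have e' : i * 3 + j = n * 3 := by omega
      rw [e', e, Nat.mod_self, h3, h4]

def Typ1 {V : Type*} [DecidableEq V] (R : Finset (Fin 7) → Finset V) : Prop :=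
  ∀ i p j q l : Fin 7, [i, p, j, q, l].Perm [1, 2, 3, 4, 5] →
    ∀ w1 ∈ R {0, i, p}, ∀ w2 ∈ R {p, j, q}, ∀ w3 ∈ R {q, l, 6},
      w1 ≠ w2 → w2 ≠ w3 → w1 ≠ w3 → False

theorem hall3 {V : Type*} [DecidableEq V] {A B C : Finset V}
    (h : ∀ w1 ∈ A, ∀ w2 ∈ B, ∀ w3 ∈ C, w1 ≠ w2 → w2 ≠ w3 → w1 ≠ w3 → False)
    (hA : 2 ≤ A.card) (hB : 2 ≤ B.card) (hC : 2 ≤ C.card) : A = B ∧ B = C ∧ B.card = 2 := by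
  have key : ∀ a ∈ A, ∃ w, w ≠ a ∧ B = {a, w} ∧ C = {a, w} := by
    intro a ha
    obtain ⟨x, hx, hxa⟩ := Finset.exists_mem_ne (by omega : 1 < B.card) a
    have hC' : ∀ y ∈ C, y = a ∨ y = x := by
      intro y hy
      by_contra hh
      push Not at hh
      exact h a ha x hx y hy hxa.symm hh.2.symm hh.1.symm
    have hC2 : C = {a, x} := by
      apply Finset.eq_of_subset_of_card_le
      · intro y hy; simpa using hC' y hy
      · exact Finset.card_le_two.trans hC
    have hxC : x ∈ C := by simp [hC2]
    have hB2 : B = {a, x} := by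
      apply Finset.eq_of_subset_of_card_le
      · intro y hy
        by_contra hh
        simp only [Finset.mem_insert, Finset.mem_singleton, not_or] at hh
        exact h a ha y hy x hxC (Ne.symm hh.1) hh.2 hxa.symm
      · exact Finset.card_le_two.trans hB
    exact ⟨x, hxa, hB2, hC2⟩
  obtain ⟨a, ha⟩ : A.Nonempty := Finset.card_pos.1 (by omega)
  obtain ⟨w, hw, h1, h2⟩ := key a ha
  have hBc : B.card = 2 := by rw [h1, Finset.card_pair hw.symm]
  refine ⟨?_, h1.trans h2.symm, hBc⟩
  apply Finset.eq_of_subset_of_card_le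
  · intro y hy
    obtain ⟨w', _, h3, _⟩ := key y hy
    simp [h3]
  · omega

theorem tri {V : Type*} [DecidableEq V] {R : Finset (Fin 7) → Finset V} (h : Typ1 R)
    (i p j q l : Fin 7) (A B C : Finset (Fin 7))
    (hh : [i, p, j, q, l].Perm [1, 2, 3, 4, 5] ∧ A = {0, i, p} ∧ B = {p, j, q} ∧
      C = {q, l, 6}) :
    ((R A).card ≤ 1 ∨ (R B).card ≤ 1 ∨ (R C).card ≤ 1) ∨
      (R A = R B ∧ R B = R C ∧ (R B).card = 2) := by
  obtain ⟨h1, rfl, rfl, rfl⟩ := hh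
  by_contra hc
  push Not at hc
  obtain ⟨⟨a1, a2, a3⟩, a4⟩ := hc
  obtain ⟨e1, e2, e3⟩ := hall3 (h i p j q l h1) (by omega) (by omega) (by omega)
  exact a4 e1 e2 e3

/-- `A`, `B` usable window triples. -/
def GP (A B : Finset (Fin 7)) : Prop := A.card = 3 ∧ B.card = 3 ∧ (A ∩ B).card = 1

instance (A B : Finset (Fin 7)) : Decidable (GP A B) := by unfold GP; infer_instance

theorem card_le_two_of {V : Type*} [DecidableEq V] {A B : Finset V} (h1 : A.card ≤ 1)
    (h2 : B.card ≤ 1) : (A ∪ B).card ≤ 2 := (Finset.card_union_le _ _).trans (by omega)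

theorem V_abs {V : Type*} [DecidableEq V] {R : Finset (Fin 7) → Finset V} (h : Typ1 R) :
    ∃ A B, (GP A B ∧ ∃ z ∈ ({4, 5, 6} : Finset (Fin 7)), z ∉ A ∪ B) ∧ (R A ∪ R B).card ≤ 2 := by
  by_contra hc
  push Not at hc
  have pr : ∀ A B : Finset (Fin 7), (GP A B ∧ ∃ z ∈ ({4, 5, 6} : Finset (Fin 7)), z ∉ A ∪ B) →
      ¬ ((R A).card ≤ 1 ∧ (R B).card ≤ 1) := by
    intro A B h1 h2
    exact absurd (card_le_two_of h2.1 h2.2) (not_le.2 (hc A B h1))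
  have cl : ∀ (i p j q l : Fin 7) (A B C : Finset (Fin 7)),
      ([i, p, j, q, l].Perm [1, 2, 3, 4, 5] ∧ A = {0, i, p} ∧ B = {p, j, q} ∧
      C = {q, l, 6}) ∧ (GP A B ∧ ∃ z ∈ ({4, 5, 6} : Finset (Fin 7)), z ∉ A ∪ B) →
      ((R A).card ≤ 1 ∨ (R B).card ≤ 1 ∨ (R C).card ≤ 1) := by
    rintro i p j q l A B C ⟨h1, h2⟩
    rcases tri h i p j q l A B C h1 with h3 | ⟨e1, e2, e3⟩
    · exact h3
    · have := hc A B h2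
      rw [e1, Finset.union_self] at this
      omega
  clear hc h

  have c1 := cl 4 2 5 1 3 {0, 2, 4} {1, 2, 5} {1, 3, 6} (by decide)
  have c2 := pr {0, 1, 4} {0, 2, 5} (by decide)
  have c3 := pr {1, 3, 6} {2, 5, 6} (by decide)
  have c4 := pr {1, 2, 5} {3, 5, 6} (by decide)
  have c5 := pr {0, 2, 4} {3, 4, 5} (by decide)
  have c6 := pr {0, 1, 5} {1, 3, 6} (by decide)
  have c7 := cl 2 5 4 3 1 {0, 2, 5} {3, 4, 5} {1, 3, 6} (by decide)
  have c8 := cl 4 1 3 5 2 {0, 1, 4} {1, 3, 5} {2, 5, 6} (by decide)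
  have c9 := pr {0, 2, 5} {2, 3, 6} (by decide)
  have c10 := pr {0, 3, 4} {2, 3, 6} (by decide)
  have c11 := pr {1, 2, 4} {1, 3, 6} (by decide)
  have c12 := cl 4 2 1 3 5 {0, 2, 4} {1, 2, 3} {3, 5, 6} (by decide)
  have c13 := cl 5 1 4 2 3 {0, 1, 5} {1, 2, 4} {2, 3, 6} (by decide)
  have c14 := pr {1, 2, 3} {2, 5, 6} (by decide)
  have c15 := cl 3 4 1 2 5 {0, 3, 4} {1, 2, 4} {2, 5, 6} (by decide)
  have c16 := pr {0, 2, 5} {1, 3, 5} (by decide)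
  have c17 := pr {0, 2, 4} {1, 2, 5} (by decide)
  have c18 := cl 4 1 5 2 3 {0, 1, 4} {1, 2, 5} {2, 3, 6} (by decide)
  have c19 := pr {1, 2, 3} {3, 4, 5} (by decide)
  clear cl pr
  grind

def SGood (A B : Finset (Fin 7)) : Prop :=
  GP A B ∧ (∃ z ∈ ({0, 1, 2} : Finset (Fin 7)), z ∉ A ∪ B) ∧
    ∃ z ∈ ({4, 5, 6} : Finset (Fin 7)), z ∉ A ∪ B

instance (A B : Finset (Fin 7)) : Decidable (SGood A B) := by unfold SGood; infer_instance

theorem S_abs {V : Type*} [DecidableEq V] {R : Finset (Fin 7) → Finset V} (h : Typ1 R) :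
    (∃ A B, SGood A B ∧ (R A ∪ R B).card ≤ 2) ∨
      ((R {0, 1, 2}).card ≤ 1 ∧ ¬ (R {3, 4, 5}).card ≤ 1) := by
  by_contra hc
  rw [not_or] at hc
  obtain ⟨hc, hcc⟩ := hc
  push Not at hc
  have pr : ∀ A B : Finset (Fin 7), SGood A B →
      ¬ ((R A).card ≤ 1 ∧ (R B).card ≤ 1) := by
    intro A B h1 h2
    exact absurd (card_le_two_of h2.1 h2.2) (not_le.2 (hc A B h1))
  have cl : ∀ (i p j q l : Fin 7) (A B C : Finset (Fin 7)),
      ([i, p, j, q, l].Perm [1, 2, 3, 4, 5] ∧ A = {0, i, p} ∧ B = {p, j, q} ∧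
      C = {q, l, 6}) ∧ (SGood A B ∨ SGood B C) →
      ((R A).card ≤ 1 ∨ (R B).card ≤ 1 ∨ (R C).card ≤ 1) := by
    rintro i p j q l A B C ⟨h1, h2⟩
    rcases tri h i p j q l A B C h1 with h3 | ⟨e1, e2, e3⟩
    · exact h3
    · rcases h2 with h2 | h2
      · have := hc A B h2
        rw [e1, Finset.union_self] at this
        omega
      · have := hc B C h2
        rw [← e2, Finset.union_self] at this
        omega
  have n345 : ¬ (R {3, 4, 5}).card ≤ 1 := by
    intro c0
    have c1 := pr {1, 5, 6} {2, 3, 6} (by decide)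
    have c2 := cl 4 1 5 2 3 {0, 1, 4} {1, 2, 5} {2, 3, 6} (by decide)
    have c3 := pr {0, 3, 4} {2, 3, 6} (by decide)
    have c4 := pr {0, 2, 5} {3, 4, 5} (by decide)
    have c5 := pr {1, 2, 4} {1, 3, 5} (by decide)
    have c6 := pr {0, 1, 4} {3, 4, 5} (by decide)
    have c7 := cl 4 3 2 1 5 {0, 3, 4} {1, 2, 3} {1, 5, 6} (by decide)
    have c8 := pr {1, 2, 5} {1, 3, 6} (by decide)
    have c9 := pr {1, 2, 3} {3, 4, 5} (by decide)
    have c10 := cl 4 1 5 3 2 {0, 1, 4} {1, 3, 5} {2, 3, 6} (by decide)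
    have c11 := cl 5 2 4 1 3 {0, 2, 5} {1, 2, 4} {1, 3, 6} (by decide)
    clear cl pr hc hcc
    grind
  have n356 : ¬ (R {3, 5, 6}).card ≤ 1 := by
    intro c0
    have c1 := pr {1, 2, 3} {3, 4, 5} (by decide)
    have c2 := pr {0, 2, 3} {3, 5, 6} (by decide)
    have c3 := pr {1, 3, 5} {2, 5, 6} (by decide)
    have c4 := cl 2 3 5 4 1 {0, 2, 3} {3, 4, 5} {1, 4, 6} (by decide)
    have c5 := cl 4 1 3 2 5 {0, 1, 4} {1, 2, 3} {2, 5, 6} (by decide)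
    have c6 := pr {1, 2, 6} {3, 5, 6} (by decide)
    have c7 := cl 5 1 2 3 4 {0, 1, 5} {1, 2, 3} {3, 4, 6} (by decide)
    have c8 := pr {0, 3, 5} {2, 5, 6} (by decide)
    have c9 := pr {0, 4, 5} {2, 3, 4} (by decide)
    have c10 := pr {0, 1, 4} {3, 4, 6} (by decide)
    have c11 := cl 5 3 4 2 1 {0, 3, 5} {2, 3, 4} {1, 2, 6} (by decide)
    have c12 := cl 4 5 3 1 2 {0, 4, 5} {1, 3, 5} {1, 2, 6} (by decide)
    have c13 := pr {1, 2, 3} {1, 4, 6} (by decide)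
    have c14 := pr {0, 1, 5} {3, 5, 6} (by decide)
    clear cl pr hc hcc
    grind
  have n346 : ¬ (R {3, 4, 6}).card ≤ 1 := by
    intro c0
    have c1 := cl 3 4 5 2 1 {0, 3, 4} {2, 4, 5} {1, 2, 6} (by decide)
    have c2 := pr {0, 2, 4} {3, 4, 6} (by decide)
    have c3 := pr {1, 2, 6} {1, 3, 4} (by decide)
    have c4 := pr {1, 3, 6} {2, 4, 6} (by decide)
    have c5 := pr {1, 2, 5} {3, 4, 5} (by decide)
    have c6 := pr {0, 3, 4} {1, 3, 6} (by decide)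
    have c7 := pr {0, 1, 5} {1, 3, 6} (by decide)
    have c8 := cl 5 1 3 4 2 {0, 1, 5} {1, 3, 4} {2, 4, 6} (by decide)
    have c9 := cl 2 4 5 3 1 {0, 2, 4} {3, 4, 5} {1, 3, 6} (by decide)
    have c10 := pr {1, 3, 4} {2, 4, 5} (by decide)
    have c11 := cl 4 2 5 1 3 {0, 2, 4} {1, 2, 5} {1, 3, 6} (by decide)
    clear cl pr hc hcc
    grind
  have n234 : ¬ (R {2, 3, 4}).card ≤ 1 := by
    intro c0
    have c1 := cl 4 5 3 1 2 {0, 4, 5} {1, 3, 5} {1, 2, 6} (by decide)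
    have c2 := pr {0, 4, 5} {2, 3, 4} (by decide)
    have c3 := pr {1, 3, 5} {2, 3, 4} (by decide)
    have c4 := pr {1, 2, 6} {2, 3, 4} (by decide)
    clear cl pr hc hcc
    grind
  have n135 : ¬ (R {1, 3, 5}).card ≤ 1 := by
    intro c0
    have c1 := pr {1, 2, 6} {1, 3, 5} (by decide)
    have c2 := pr {1, 3, 5} {2, 4, 5} (by decide)
    have c3 := cl 4 5 3 2 1 {0, 4, 5} {2, 3, 5} {1, 2, 6} (by decide)
    have c4 := pr {0, 4, 5} {1, 3, 5} (by decide)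
    have c5 := cl 3 4 5 2 1 {0, 3, 4} {2, 4, 5} {1, 2, 6} (by decide)
    have c6 := pr {0, 3, 4} {2, 3, 5} (by decide)
    clear cl pr hc hcc
    grind
  have n012 : (R {0, 1, 2}).card ≤ 1 := by
    by_contra n012
    have d1 := tri h 1 2 4 3 5 {0, 1, 2} {2, 3, 4} {3, 5, 6} (by decide)
    have d2 := tri h 2 1 5 3 4 {0, 1, 2} {1, 3, 5} {3, 4, 6} (by decide)
    have d1' : R {0, 1, 2} = R {2, 3, 4} ∧ (R {2, 3, 4}).card = 2 := by tauto
    have d2' : R {0, 1, 2} = R {1, 3, 5} := by tauto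
    have := hc {2, 3, 4} {1, 3, 5} (by decide)
    rw [← d2', d1'.1, Finset.union_self] at this
    omega
  exact hcc ⟨n012, n345⟩

def RR {V : Type*} [DecidableEq V] (col : Finset V → Bool) (b : Bool) (W : Finset V)
    (g : Fin 7 → V) (T : Finset (Fin 7)) : Finset V :=
  W.filter (fun w => col (insert w (T.image g)) = b)

section win
variable {V : Type*} [DecidableEq V] {col : Finset V → Bool} {b : Bool}

theorem path3 {a i p j q l z w1 w2 w3 : V} (hn : [a, i, p, j, q, l, w1, w2, w3].Nodup)
    (h1 : col {a, i, w1, p} = b) (h2 : col {p, j, w2, q} = b) (h3 : col {q, l, w3, z} = b) :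
    LPath col b a z {a, i, w1, p, j, w2, q, l, w3} 3 := by
  simp only [List.nodup_cons, List.mem_cons, List.not_mem_nil, not_or, or_false] at hn
  have e1 := LPath.edge' (by tauto) (by tauto) (by tauto) h1
  have e2 := LPath.edge' (by tauto) (by tauto) (by tauto) h2
  have e3 := LPath.edge' (by tauto) (by tauto) (by tauto) h3
  have e4 := e2.append e3 (by
    simp only [Finset.disjoint_left, Finset.mem_insert, Finset.mem_singleton]; grind)
  exact e1.append' e4 (by
    simp only [Finset.disjoint_left, Finset.mem_insert, Finset.mem_singleton, Finset.mem_union]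
    grind) (by simp only [Finset.insert_union, Finset.singleton_union]) rfl

theorem path2 {a i p j q z c : V} (hn : [a, i, p, c, j, q].Nodup)
    (h1 : col {a, i, p, c} = b) (h2 : col {c, j, q, z} = b) :
    LPath col b a z {a, i, p, c, j, q} 2 := by
  simp only [List.nodup_cons, List.mem_cons, List.not_mem_nil, not_or, or_false] at hn
  have e1 := LPath.edge' (by tauto) (by tauto) (by tauto) h1
  have e2 := LPath.edge' (by tauto) (by tauto) (by tauto) h2
  exact e1.append' e2 (by
    simp only [Finset.disjoint_left, Finset.mem_insert, Finset.mem_singleton]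
    grind) (by simp only [Finset.insert_union, Finset.singleton_union]) rfl

theorem typ1_of {W T R' : Finset V} {g : Fin 7 → V} {t : V} {k k' n : ℕ}
    (hg : Function.Injective g) (hgW : ∀ i, g i ∉ W)
    (hT : LPath col b t (g 0) T k) (hR : LPath col b (g 6) t R' k')
    (hTR : Disjoint T R') (hTW : Disjoint T W) (hRW : Disjoint R' W)
    (hgT : ∀ i, i ≠ 6 → g i ∉ T) (hgR : ∀ i, i ≠ 6 → g i ∉ R')
    (hn : k + k' + 3 = n) (hno : ¬ Cyc col b n) : Typ1 (RR col b W g) := by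
  intro i p j q l hp w1 hw1 w2 hw2 w3 hw3 n1 n2 n3
  apply hno
  have nd : [i, p, j, q, l].Nodup := by rw [hp.nodup_iff]; decide
  have hmem : ∀ x ∈ [i, p, j, q, l], x ≠ 0 ∧ x ≠ 6 := by
    intro x hx
    rw [hp.mem_iff] at hx
    revert x; decide
  simp only [RR, Finset.mem_filter] at hw1 hw2 hw3
  simp only [List.nodup_cons, List.mem_cons, List.not_mem_nil, not_or, or_false] at nd
  simp only [List.mem_cons, List.not_mem_nil, or_false, forall_eq_or_imp, forall_eq] at hmem
  have inj : ∀ {x y : Fin 7}, x ≠ y → g x ≠ g y := fun h h' => h (hg h')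
  have hw : ∀ x, ∀ w ∈ W, g x ≠ w := fun x w hw h => hgW x (h ▸ hw)
  have P3 := path3 (col := col) (b := b) (a := g 0) (i := g i) (p := g p) (j := g j) (q := g q)
    (l := g l) (z := g 6) (w1 := w1) (w2 := w2) (w3 := w3) (by
      simp only [List.nodup_cons, List.mem_cons, List.not_mem_nil, not_or, or_false,
        hw _ w1 hw1.1, hw _ w2 hw2.1, hw _ w3 hw3.1]
      simp only [hg.eq_iff]
      refine ⟨?_, ?_⟩ <;> grind)
    (by rw [← hw1.2]; congr 1; ext; simp; tauto)
    (by rw [← hw2.2]; congr 1; ext; simp; tauto)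
    (by rw [← hw3.2]; congr 1; ext; simp; tauto)
  have hd : ∀ X : Finset V, (∀ i, i ≠ 6 → g i ∉ X) → Disjoint X W →
      Disjoint X {g 0, g i, w1, g p, g j, w2, g q, g l, w3} := by
    intro X h1 h2
    rw [Finset.disjoint_right] at h2
    rw [Finset.disjoint_right]
    intro y hy
    simp only [Finset.mem_insert, Finset.mem_singleton] at hy
    rcases hy with rfl | rfl | rfl | rfl | rfl | rfl | rfl | rfl | rfl
    · exact h1 _ (by decide)
    · exact h1 _ hmem.1.2
    · exact h2 hw1.1
    · exact h1 _ hmem.2.1.2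
    · exact h1 _ hmem.2.2.1.2
    · exact h2 hw2.1
    · exact h1 _ hmem.2.2.2.1.2
    · exact h1 _ hmem.2.2.2.2.2
    · exact h2 hw3.1
  refine ⟨t, _, (hT.append P3 (hd _ hgT hTW)).append' hR ?_ rfl (by omega)⟩
  rw [Finset.disjoint_union_left]
  exact ⟨hTR, (hd _ hgR hRW).symm⟩

theorem blue_of {W : Finset V} {g : Fin 7 → V}
    (hg : Function.Injective g) (hgW : ∀ i, g i ∉ W) {A B : Finset (Fin 7)} (hAB : GP A B)
    {y y' : V} (hy : y ∈ W) (hyD : y ∉ RR col b W g A ∪ RR col b W g B) (hy' : y' ∈ W)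
    (hyD' : y' ∉ RR col b W g A ∪ RR col b W g B) :
    LPath col (!b) y y' (insert y ((A ∪ B).image g)) 2 := by
  obtain ⟨hA, hB, hC⟩ := hAB
  obtain ⟨c, hc⟩ := Finset.card_eq_one.1 hC
  have hcA : c ∈ A := (Finset.mem_inter.1 (hc ▸ Finset.mem_singleton_self c : c ∈ A ∩ B)).1
  have hcB : c ∈ B := (Finset.mem_inter.1 (hc ▸ Finset.mem_singleton_self c : c ∈ A ∩ B)).2
  have hi : ∀ x, x ∈ A → x ∈ B → x = c := fun x h1 h2 => by
    have : x ∈ A ∩ B := Finset.mem_inter.2 ⟨h1, h2⟩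
    rw [hc] at this; simpa using this
  have hnW : ∀ T : Finset (Fin 7), ∀ w ∈ W, w ∉ T.image g := by
    intro T w hw h
    obtain ⟨x, _, rfl⟩ := Finset.mem_image.1 h
    exact hgW x hw
  simp only [RR, Finset.mem_union, Finset.mem_filter, not_or, not_and] at hyD hyD'
  have e1 := LPath.edge (col := col) (b := !b) (F := insert y (A.image g)) (x := y) (y := g c)
    (by rw [Finset.card_insert_of_notMem (hnW _ _ hy), Finset.card_image_of_injective _ hg, hA])
    (by simp) (by simp [hg.eq_iff, hcA]) (fun h => hgW c (h ▸ hy))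
    (by have := hyD.1 hy; revert this; cases col (insert y (A.image g)) <;> cases b <;> simp)
  have e2 := LPath.edge (col := col) (b := !b) (F := insert y' (B.image g)) (x := g c) (y := y')
    (by rw [Finset.card_insert_of_notMem (hnW _ _ hy'), Finset.card_image_of_injective _ hg, hB])
    (by simp [hg.eq_iff, hcB]) (by simp) (fun h => hgW c (h ▸ hy'))
    (by have := hyD'.2 hy'; revert this; cases col (insert y' (B.image g)) <;> cases b <;> simp)
  rw [Finset.erase_insert (hnW _ _ hy')] at e2
  refine e1.append' e2 ?_ ?_ rfl
  · rw [Finset.disjoint_left]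
    intro x hx hx2
    rw [Finset.mem_erase, Finset.mem_insert] at hx
    rcases hx with ⟨h1, rfl | h2⟩
    · exact hnW _ _ hy hx2
    · obtain ⟨z, hz, rfl⟩ := Finset.mem_image.1 h2
      obtain ⟨z', hz', e⟩ := Finset.mem_image.1 hx2
      obtain rfl := hg e
      exact h1 (by rw [hi _ hz hz'])
  · rw [Finset.image_union, Finset.erase_insert_of_ne (fun h : y = g c => hgW c (h ▸ hy)),
      Finset.insert_union]
    congr 1
    ext x
    simp only [Finset.mem_union, Finset.mem_erase]
    constructor
    · tauto
    · rintro (h | h)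
      · by_cases hx : x = g c
        · right; rw [hx]; exact Finset.mem_image_of_mem _ hcB
        · left; exact ⟨hx, h⟩
      · right; exact h

end win

section chain
variable {V : Type*} [DecidableEq V] {col : Finset V → Bool} {b : Bool}

theorem inj7 {a x1 x2 x3 x4 x5 z : V} (h : [a, x1, x2, x3, x4, x5, z].Nodup) :
    Function.Injective ![a, x1, x2, x3, x4, x5, z] := by
  rw [← List.nodup_ofFn]
  simpa using h

theorem LPath.inv2 {w z : V} {R : Finset V} {k : ℕ} (h : LPath col b w z R (k + 2)) :
    ∃ x1 x2 x3 x4 x5 y R', LPath col b y z R' k ∧ [w, x1, x2, x3, x4, x5].Nodup ∧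
      (∀ x ∈ [w, x1, x2, x3, x4, x5], x ∉ R') ∧ col {w, x1, x2, x3} = b ∧
      col {x3, x4, x5, y} = b ∧ R = {w, x1, x2, x3, x4, x5} ∪ R' := by
  obtain ⟨x1, x2, x3, T, h', a1, a2, a3, a4, a5, a6, a7, rfl⟩ := h.inv
  obtain ⟨x4, x5, y, R', h'', b1, b2, b3, b4, b5, b6, b7, rfl⟩ := h'.inv
  refine ⟨x1, x2, x3, x4, x5, y, R', h'', ?_, ?_, a7, b7, ?_⟩
  · simp only [Finset.mem_insert, not_or] at a4 a5 a6
    simp only [List.nodup_cons, List.mem_cons, List.not_mem_nil, not_or, or_false]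
    simp [*]
  · simp only [Finset.mem_insert, not_or] at a4 a5 a6
    simp [*]
  · simp only [Finset.insert_union, Finset.singleton_union]

/-- Chain of blue windows. -/
def BChain (col : Finset V → Bool) (b : Bool) (W D1 D U J : Finset V) (n : ℕ) : Prop :=
  ∀ y ∈ W, y ∉ D1 → y ∉ J → ∀ y' ∈ W, y' ∉ D → y' ∉ J → LPath col b y y' (insert y (U ∪ J)) n

theorem BChain.ext {W W' D1 D D' U U2 J : Finset V} {n : ℕ} (h : BChain col b W D1 D U J n)
    (h2 : BChain col b W D' D' U2 ∅ 2) (hUU : Disjoint U U2) (hUW : Disjoint U W)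
    (hU2W : Disjoint U2 W) (hJ : J ⊆ W') (hW : W' ⊆ W) (hc : J.card + 4 < W'.card)
    (hD : D.card ≤ 2) (hD' : D'.card ≤ 2) :
    ∃ j ∈ W', j ∉ J ∧ BChain col b W D1 D' (U ∪ U2) (insert j J) (n + 2) := by
  have : (J ∪ (D ∪ D')).card < W'.card := by
    have := Finset.card_union_le J (D ∪ D')
    have := Finset.card_union_le D D'
    omega
  obtain ⟨j, hj, hj'⟩ := Finset.exists_mem_notMem_of_card_lt_card this
  simp only [Finset.mem_union, not_or] at hj'
  refine ⟨j, hj, hj'.1, ?_⟩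
  intro y hy hy1 hyJ y' hy' hy'1 hyJ'
  simp only [Finset.mem_insert, not_or] at hyJ hyJ'
  have e1 := h y hy hy1 hyJ.2 j (hW hj) hj'.2.1 hj'.1
  have e2 := h2 j (hW hj) hj'.2.2 (by simp) y' hy' hy'1 (by simp)
  rw [Finset.disjoint_left] at hUU hUW hU2W
  refine e1.append' e2 ?_ ?_ rfl
  · rw [Finset.disjoint_left]
    intro x hx hx2
    simp only [Finset.mem_insert, Finset.mem_union, Finset.notMem_empty, or_false] at hx hx2
    have hJW := fun x (hx : x ∈ J) => hW (hJ hx)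
    have := hW hj
    grind
  · ext x
    simp only [Finset.mem_insert, Finset.mem_union, Finset.notMem_empty, or_false]
    tauto

structure St (col : Finset V → Bool) (b : Bool) (W W' : Finset V) (v0 u' : V) (D1 : Finset V)
    (s : ℕ) (P : Finset V) (w u : V) (U J D : Finset V) : Prop where
  p1 : LPath col b v0 w (P.erase w) (2 * s)
  p2 : LPath col b v0 u (P.erase u) (2 * s)
  p3 : LPath col b u' w (P.erase w) (2 * s)
  p4 : LPath col b u' u (P.erase u) (2 * s)
  hw : w ∈ P
  hu : u ∈ P
  hPW : Disjoint P W
  hUP : U ⊆ P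
  huU : u ∉ U
  huU' : u' ∉ U
  hJ : J ⊆ W'
  hJc : J.card + 1 = s
  hD : D.card ≤ 2
  hD1 : D1.card ≤ 2
  blue : BChain col (!b) W D1 D U J (2 * s)

theorem card4 {x y z w : V} (h : [x, y, z, w].Nodup) : ({x, y, z, w} : Finset V).card = 4 := by
  have := List.toFinset_card_of_nodup h
  simpa using this

theorem two_edges {w x1 x2 x3 x4 x5 z : V} (nd : [w, x1, x2, x3, x4, x5, z].Nodup)
    (h1 : col {w, x1, x2, x3} = b) (h2 : col {x3, x4, x5, z} = b) {s e : V}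
    (hs : s = w ∨ s = x1 ∨ s = x2) (he : e = x4 ∨ e = x5 ∨ e = z) :
    LPath col b s e (({w, x1, x2, x3, x4, x5, z} : Finset V).erase e) 2 := by
  simp only [List.nodup_cons, List.mem_cons, List.not_mem_nil, not_or, or_false] at nd
  have e1 := LPath.edge (x := s) (y := x3) (card4 (by simp; tauto)) (by simp; tauto) (by simp) (by grind) h1
  have e2 := LPath.edge (x := x3) (y := e) (card4 (by simp; tauto)) (by simp) (by simp; tauto) (by grind) h2
  refine e1.append' e2 ?_ ?_ rfl
  · rw [Finset.disjoint_left]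
    simp only [Finset.mem_insert, Finset.mem_erase, Finset.mem_singleton]
    grind
  · ext x
    simp only [Finset.mem_insert, Finset.mem_union, Finset.mem_erase, Finset.mem_singleton]
    grind

/-- Data of one blue window. -/
theorem window {W T R' : Finset V} {a x1 x2 x3 x4 x5 z t : V} {k k' n : ℕ}
    (nd : [a, x1, x2, x3, x4, x5, z].Nodup)
    (hW : ∀ x ∈ [a, x1, x2, x3, x4, x5, z], x ∉ W)
    (hT : LPath col b t a T k) (hR : LPath col b z t R' k')
    (hTR : Disjoint T R') (hTW : Disjoint T W) (hRW : Disjoint R' W)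
    (hgT : ∀ x ∈ [a, x1, x2, x3, x4, x5], x ∉ T) (hgR : ∀ x ∈ [a, x1, x2, x3, x4, x5], x ∉ R')
    (hn : k + k' + 3 = n) (hno : ¬ Cyc col b n) :
    Function.Injective ![a, x1, x2, x3, x4, x5, z] ∧ (∀ i, ![a, x1, x2, x3, x4, x5, z] i ∉ W) ∧
    Typ1 (RR col b W ![a, x1, x2, x3, x4, x5, z]) := by
  have hi := inj7 nd
  have hw : ∀ i, ![a, x1, x2, x3, x4, x5, z] i ∉ W := by
    simp only [List.mem_cons, List.not_mem_nil, or_false, forall_eq_or_imp, forall_eq] at hW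
    simp [Fin.forall_fin_succ, hW]
  refine ⟨hi, hw, typ1_of hi hw (t := t) (T := T) (R' := R') hT hR hTR hTW hRW ?_ ?_ hn hno⟩
  · simp only [List.mem_cons, List.not_mem_nil, or_false, forall_eq_or_imp, forall_eq] at hgT
    intro i hi
    fin_cases i <;> simp_all
  · simp only [List.mem_cons, List.not_mem_nil, or_false, forall_eq_or_imp, forall_eq] at hgR
    intro i hi
    fin_cases i <;> simp_all

theorem winV {W : Finset V} {a x1 x2 x3 x4 x5 z : V}
    (hi : Function.Injective ![a, x1, x2, x3, x4, x5, z])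
    (hw : ∀ i, ![a, x1, x2, x3, x4, x5, z] i ∉ W)
    (h : Typ1 (RR col b W ![a, x1, x2, x3, x4, x5, z])) :
    ∃ U D u, U ⊆ {a, x1, x2, x3, x4, x5, z} ∧ (u = x4 ∨ u = x5 ∨ u = z) ∧ u ∉ U ∧ D.card ≤ 2 ∧
      BChain col (!b) W D D U ∅ 2 := by
  obtain ⟨A, B, ⟨hAB, i, hi1, hi2⟩, hD⟩ := V_abs h
  refine ⟨(A ∪ B).image ![a, x1, x2, x3, x4, x5, z], _, ![a, x1, x2, x3, x4, x5, z] i,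
    ?_, ?_, ?_, hD, ?_⟩
  · intro x hx
    obtain ⟨j, _, rfl⟩ := Finset.mem_image.1 hx
    fin_cases j <;> simp
  · simp only [Finset.mem_insert, Finset.mem_singleton] at hi1
    rcases hi1 with rfl | rfl | rfl <;> simp
  · rw [Finset.mem_image]
    rintro ⟨j, hj, e⟩
    exact hi2 (hi e ▸ hj)
  · intro y hy hy1 _ y' hy' hy1' _
    rw [Finset.union_empty]
    exact blue_of hi hw hAB hy hy1 hy' hy1'

theorem winS {W : Finset V} {a x1 x2 x3 x4 x5 z : V}
    (hi : Function.Injective ![a, x1, x2, x3, x4, x5, z])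
    (hw : ∀ i, ![a, x1, x2, x3, x4, x5, z] i ∉ W)
    (h : Typ1 (RR col b W ![a, x1, x2, x3, x4, x5, z])) :
    (∃ U D u' u, U ⊆ {a, x1, x2, x3, x4, x5, z} ∧ (u' = a ∨ u' = x1 ∨ u' = x2) ∧ u' ∉ U ∧
      (u = x4 ∨ u = x5 ∨ u = z) ∧ u ∉ U ∧ D.card ≤ 2 ∧ BChain col (!b) W D D U ∅ 2) ∨
    ((W.filter (fun w => col (insert w {a, x1, x2}) = b)).card ≤ 1 ∧
      ¬ (W.filter (fun w => col (insert w {x3, x4, x5}) = b)).card ≤ 1) := by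
  rcases S_abs h with ⟨A, B, ⟨hAB, ⟨i', hi1', hi2'⟩, i, hi1, hi2⟩, hD⟩ | h
  · left
    refine ⟨(A ∪ B).image ![a, x1, x2, x3, x4, x5, z], _, ![a, x1, x2, x3, x4, x5, z] i',
      ![a, x1, x2, x3, x4, x5, z] i, ?_, ?_, ?_, ?_, ?_, hD, ?_⟩
    · intro x hx
      obtain ⟨j, _, rfl⟩ := Finset.mem_image.1 hx
      fin_cases j <;> simp
    · simp only [Finset.mem_insert, Finset.mem_singleton] at hi1'
      rcases hi1' with rfl | rfl | rfl <;> simp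
    · rw [Finset.mem_image]
      rintro ⟨j, hj, e⟩
      exact hi2' (hi e ▸ hj)
    · simp only [Finset.mem_insert, Finset.mem_singleton] at hi1
      rcases hi1 with rfl | rfl | rfl <;> simp
    · rw [Finset.mem_image]
      rintro ⟨j, hj, e⟩
      exact hi2 (hi e ▸ hj)
    · intro y hy hy1 _ y' hy' hy1' _
      rw [Finset.union_empty]
      exact blue_of hi hw hAB hy hy1 hy' hy1'
  · right
    unfold RR at h
    have e1 : (({0, 1, 2} : Finset (Fin 7)).image ![a, x1, x2, x3, x4, x5, z]) = {a, x1, x2} := by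
      simp [Finset.image_insert]
    have e2 : (({3, 4, 5} : Finset (Fin 7)).image ![a, x1, x2, x3, x4, x5, z]) = {x3, x4, x5} := by
      simp [Finset.image_insert]
    rwa [e1, e2] at h

theorem St.step {W W' D1 P U J D R : Finset V} {v0 u' w u : V} {s k : ℕ}
    (h : St col b W W' v0 u' D1 s P w u U J D) (hR : LPath col b w v0 R (k + 2)) (hk : k ≠ 0)
    (hRP : ∀ x ∈ R, x ∈ P → x = w) (hRW : Disjoint R W) (hno : ¬ Cyc col b (2 * s + k + 3))
    (hW : W' ⊆ W) (hc : s + 3 < W'.card) :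
    ∃ P w u U J D R, St col b W W' v0 u' D1 (s + 1) P w u U J D ∧ LPath col b w v0 R k ∧
      (∀ x ∈ R, x ∈ P → x = w) ∧ Disjoint R W := by
  obtain ⟨x1, x2, x3, x4, x5, z, R', hz, nd, hxR, c1, c2, rfl⟩ := hR.inv2
  have hzR := hz.mem_start hk
  have hRW' := Finset.disjoint_left.1 hRW
  have hPW' := Finset.disjoint_left.1 h.hPW
  have hw := h.hw
  have hu := h.hu
  have huP := h.p4.mem_start (by have := h.hJc; omega)
  rw [Finset.mem_erase] at huP
  have hxP : ∀ x ∈ [x1, x2, x3, x4, x5], x ∉ P := by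
    simp only [List.nodup_cons, List.mem_cons, List.not_mem_nil, not_or, or_false] at nd
    intro x hx hxP
    have := hRP x (by
      simp only [List.mem_cons, List.not_mem_nil, or_false] at hx
      simp only [Finset.mem_union, Finset.mem_insert, Finset.mem_singleton]
      tauto) hxP
    subst this
    simp only [List.mem_cons, List.not_mem_nil, or_false] at hx
    tauto
  have hzw : z ≠ w := by
    rintro rfl
    exact hxR _ (by simp) hzR
  have hzP : z ∉ P := fun hh => hzw (hRP z (by simp [hzR]) hh)
  have hR'P : ∀ x ∈ R', x ∉ P := by
    intro x hx hh
    have := hRP x (by simp [hx]) hh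
    subst this
    exact hxR _ (by simp) hx
  have hxz : ∀ x ∈ [w, x1, x2, x3, x4, x5], x ≠ z := by
    rintro x hx rfl
    exact hxR _ hx hzR
  have hxW : ∀ x ∈ [w, x1, x2, x3, x4, x5], x ∉ W := by
    intro x hx
    refine hRW' ?_
    simp only [List.mem_cons, List.not_mem_nil, or_false] at hx
    simp only [Finset.mem_union, Finset.mem_insert, Finset.mem_singleton]
    tauto
  have hzW : z ∉ W := hRW' (by simp [hzR])
  have ndw : [w, x1, x2, x3, x4, x5, z].Nodup := by
    have e : [w, x1, x2, x3, x4, x5, z] = [w, x1, x2, x3, x4, x5] ++ [z] := rfl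
    rw [e, List.nodup_append]
    refine ⟨nd, by simp, ?_⟩
    intro x hx y hy
    rw [List.mem_singleton] at hy
    rw [hy]
    exact hxz x hx
  have hXP : ∀ x ∈ ({x1, x2, x3, x4, x5, z} : Finset V), x ∉ P := by
    intro x hx
    have hx : x ∈ [x1, x2, x3, x4, x5] ∨ x = z := by
      simp only [List.mem_cons, List.not_mem_nil, or_false, Finset.mem_insert,
        Finset.mem_singleton, or_assoc] at hx ⊢
      exact hx
    rcases hx with hx | rfl
    · exact hxP x hx
    · exact hzP
  have hXW : ∀ x ∈ ({x1, x2, x3, x4, x5, z} : Finset V), x ∉ W := by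
    intro x hx
    have hx : x ∈ [x1, x2, x3, x4, x5] ∨ x = z := by
      simp only [List.mem_cons, List.not_mem_nil, or_false, Finset.mem_insert,
        Finset.mem_singleton, or_assoc] at hx ⊢
      exact hx
    rcases hx with hx | rfl
    · exact hxW x (List.mem_cons_of_mem _ hx)
    · exact hzW
  have ndu : [u, x1, x2, x3, x4, x5, z].Nodup := by
    rw [List.nodup_cons] at ndw ⊢
    refine ⟨fun hh => hXP u ?_ hu, ndw.2⟩
    simpa using hh
  have hR'W : Disjoint R' W := Finset.disjoint_left.2 fun x hx => hRW' (by simp [hx])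
  obtain ⟨hi, hw7, ht⟩ := window (col := col) (b := b) (W := W) (T := P.erase u) (R' := R')
    (t := v0) ndu (by
      intro x hx
      rcases List.mem_cons.1 hx with rfl | hx
      · exact hPW' hu
      · exact hXW x (by simpa using hx))
    h.p2 hz (Finset.disjoint_left.2 fun x hx hx' => hR'P x hx' (Finset.mem_of_mem_erase hx))
    (Finset.disjoint_left.2 fun x hx => hPW' (Finset.mem_of_mem_erase hx)) hR'W
    (by
      intro x hx
      rcases List.mem_cons.1 hx with rfl | hx
      · simp
      · exact fun hh => hxP x hx (Finset.mem_of_mem_erase hh))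
    (by
      intro x hx
      rcases List.mem_cons.1 hx with rfl | hx
      · exact fun hh => hR'P _ hh hu
      · exact hxR x (List.mem_cons_of_mem _ hx)) rfl hno
  obtain ⟨U2, D2, u2, hU2, hu2, hu2U, hD2, hB⟩ := winV hi hw7 ht
  have hmem3 : ∀ e, (e = x4 ∨ e = x5 ∨ e = z) → e ∈ ({x1, x2, x3, x4, x5, z} : Finset V) := by
    rintro e (rfl | rfl | rfl) <;> simp
  have hu2P : u2 ∉ P := hXP _ (hmem3 _ hu2)
  have hU2P : ∀ x ∈ U2, x ∈ P → x = u := by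
    intro x hx hxP'
    rcases Finset.mem_insert.1 (hU2 hx) with rfl | hx'
    · rfl
    · exact absurd hxP' (hXP x hx')
  have hU2W : Disjoint U2 W := by
    rw [Finset.disjoint_left]
    intro x hx
    rcases Finset.mem_insert.1 (hU2 hx) with rfl | hx'
    · exact hPW' hu
    · exact hXW x hx'
  obtain ⟨j, hj, hjJ, hB'⟩ := h.blue.ext (W' := W') hB
    (Finset.disjoint_left.2 fun x hx hx2 => by
      have := hU2P x hx2 (h.hUP hx)
      subst this
      exact h.huU hx) (Finset.disjoint_left.2 fun x hx => hPW' (h.hUP hx)) hU2W h.hJ hW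
    (by have := h.hJc; omega) h.hD hD2
  have hsub : ∀ x ∈ ({w, x1, x2, x3, x4, x5, z} : Finset V), x ∈ P → x = w := by
    intro x hx hxP'
    rcases Finset.mem_insert.1 hx with rfl | hx'
    · rfl
    · exact absurd hxP' (hXP x hx')
  have ext2 : ∀ q e, LPath col b q w (P.erase w) (2 * s) → (e = x4 ∨ e = x5 ∨ e = z) →
      LPath col b q e ((P ∪ {w, x1, x2, x3, x4, x5, z}).erase e) (2 * (s + 1)) := by
    intro q e hq he
    have heP : e ∉ P := hXP _ (hmem3 _ he)
    refine hq.append' (two_edges ndw c1 c2 (Or.inl rfl) he) ?_ ?_ (by ring)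
    · rw [Finset.disjoint_left]
      intro x hx hx2
      rw [Finset.mem_erase] at hx hx2
      exact hx.1 (hsub x hx2.2 hx.2)
    · rw [Finset.erase_union_distrib, Finset.erase_eq_of_notMem heP]
      ext x
      simp only [Finset.mem_union, Finset.mem_erase]
      have : w ≠ e := fun hh => heP (hh ▸ hw)
      have hww : w ∈ ({w, x1, x2, x3, x4, x5, z} : Finset V) := by simp
      generalize ({w, x1, x2, x3, x4, x5, z} : Finset V) = Y at hww
      clear * - this hww hw
      by_cases hx : x = w
      · subst hx; simp [this, hww]
      · simp [hx]
  refine ⟨P ∪ {w, x1, x2, x3, x4, x5, z}, z, u2, U ∪ U2, insert j J, D2, R',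
    ⟨ext2 _ _ h.p1 (by simp), ext2 _ _ h.p1 hu2, ext2 _ _ h.p3 (by simp), ext2 _ _ h.p3 hu2,
      by simp, ?_, ?_, ?_, ?_, ?_, ?_, ?_, hD2, h.hD1, ?_⟩, hz, ?_, hR'W⟩
  · rcases hu2 with rfl | rfl | rfl <;> simp
  · rw [Finset.disjoint_union_left]
    refine ⟨h.hPW, Finset.disjoint_left.2 ?_⟩
    intro x hx
    rcases Finset.mem_insert.1 hx with rfl | hx'
    · exact hPW' hw
    · exact hXW x hx'
  · intro x hx
    rcases Finset.mem_union.1 hx with hx | hx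
    · exact Finset.mem_union_left _ (h.hUP hx)
    · rcases Finset.mem_insert.1 (hU2 hx) with rfl | hx'
      · exact Finset.mem_union_left _ hu
      · exact Finset.mem_union_right _ (Finset.mem_insert_of_mem hx')
  · rw [Finset.mem_union, not_or]
    exact ⟨fun hh => hu2P (h.hUP hh), hu2U⟩
  · rw [Finset.mem_union, not_or]
    exact ⟨h.huU', fun hh => huP.1 (hU2P _ hh huP.2)⟩
  · intro x hx
    rcases Finset.mem_insert.1 hx with rfl | hx
    · exact hj
    · exact h.hJ hx
  · rw [Finset.card_insert_of_notMem hjJ, h.hJc]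
  · exact hB'
  · intro x hx hxP'
    rcases Finset.mem_union.1 hxP' with hh | hh
    · exact absurd hh (hR'P x hx)
    · have hh : x ∈ [w, x1, x2, x3, x4, x5] ∨ x = z := by
        simp only [List.mem_cons, List.not_mem_nil, or_false, Finset.mem_insert,
          Finset.mem_singleton, or_assoc] at hh ⊢
        exact hh
      rcases hh with hh | hh
      · exact absurd hx (hxR x hh)
      · exact hh
end chain

section chain2
variable {V : Type*} [DecidableEq V] {col : Finset V → Bool} {b : Bool}

theorem St.last {W W' D1 P U J D R : Finset V} {v0 u' w u : V} {s : ℕ}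
    (h : St col b W W' v0 u' D1 s P w u U J D) (hR : LPath col b w v0 R 2)
    (hRP : ∀ x ∈ R, x ∈ P → x = w) (hRW : Disjoint R W) (hno : ¬ Cyc col b (2 * s + 3))
    (hW : W' ⊆ W) (hc : s + 3 < W'.card) :
    ∃ U J D, BChain col (!b) W D1 D U J (2 * (s + 1)) ∧ Disjoint U W ∧ J ⊆ W' ∧ J.card = s ∧
      D.card ≤ 2 := by
  obtain ⟨x1, x2, x3, x4, x5, z, R', hz, nd, hxR, c1, c2, rfl⟩ := LPath.inv2 (k := 0) hR
  clear hz hxR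
  have hRW' := Finset.disjoint_left.1 hRW
  have hPW' := Finset.disjoint_left.1 h.hPW
  have hu := h.hu
  have huP := h.p4.mem_start (by have := h.hJc; omega)
  rw [Finset.mem_erase] at huP
  have hxP : ∀ x ∈ [x1, x2, x3, x4, x5], x ∉ P := by
    intro x hx hxP
    have := hRP x (by
      have : x ∈ [w, x1, x2, x3, x4, x5] := List.mem_cons_of_mem _ hx
      rw [Finset.mem_union]
      left
      simpa using this) hxP
    subst this
    rw [List.nodup_cons] at nd
    exact nd.1 hx
  have hxW : ∀ x ∈ [x1, x2, x3, x4, x5], x ∉ W := by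
    intro x hx
    refine hRW' ?_
    have : x ∈ [w, x1, x2, x3, x4, x5] := List.mem_cons_of_mem _ hx
    rw [Finset.mem_union]
    left
    simpa using this
  have hcase : ∀ x ∈ [u, x1, x2, x3, x4, x5, u'], x = u ∨ x ∈ [x1, x2, x3, x4, x5] ∨ x = u' := by
    intro x hx
    simp only [List.mem_cons, List.not_mem_nil, or_false, or_assoc] at hx ⊢
    exact hx
  have ndu : [u, x1, x2, x3, x4, x5, u'].Nodup := by
    have e : [u, x1, x2, x3, x4, x5, u'] = u :: ([x1, x2, x3, x4, x5] ++ [u']) := rfl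
    rw [e, List.nodup_cons, List.nodup_append, List.mem_append, List.mem_singleton]
    refine ⟨?_, (List.nodup_cons.1 nd).2, by simp, ?_⟩
    · rintro (hh | hh)
      · exact hxP _ hh hu
      · exact huP.1 hh.symm
    · intro x hx y hy
      rw [List.mem_singleton] at hy
      rw [hy]
      rintro rfl
      exact hxP _ hx huP.2
  obtain ⟨hi, hw7, ht⟩ := window (col := col) (b := b) (W := W) (T := P.erase u) (R' := ∅)
    (t := u') (k' := 0) ndu (by
      intro x hx
      rcases hcase x hx with rfl | hx | rfl
      · exact hPW' hu
      · exact hxW x hx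
      · exact hPW' huP.2)
    h.p4 (LPath.nil _) (by simp)
    (Finset.disjoint_left.2 fun x hx => hPW' (Finset.mem_of_mem_erase hx)) (by simp)
    (by
      intro x hx
      rcases List.mem_cons.1 hx with rfl | hx
      · simp
      · exact fun hh => hxP x hx (Finset.mem_of_mem_erase hh))
    (by simp) rfl hno
  obtain ⟨U2, D2, u2, hU2, -, -, hD2, hB⟩ := winV hi hw7 ht
  have hU2' : ∀ x ∈ U2, x = u ∨ x ∈ [x1, x2, x3, x4, x5] ∨ x = u' := by
    intro x hx
    exact hcase x (by simpa using hU2 hx)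
  have hU2W : Disjoint U2 W := by
    rw [Finset.disjoint_left]
    intro x hx
    rcases hU2' x hx with rfl | hx | rfl
    · exact hPW' hu
    · exact hxW x hx
    · exact hPW' huP.2
  have hUW : Disjoint U W := Finset.disjoint_left.2 fun x hx => hPW' (h.hUP hx)
  obtain ⟨j, hj, hjJ, hB'⟩ := h.blue.ext (W' := W') hB
    (Finset.disjoint_left.2 fun x hx hx2 => by
      rcases hU2' x hx2 with rfl | hx2 | rfl
      · exact h.huU hx
      · exact hxP x hx2 (h.hUP hx)
      · exact h.huU' hx) hUW hU2W h.hJ hW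
    (by have := h.hJc; omega) h.hD hD2
  refine ⟨_, _, _, hB', ?_, ?_, ?_, hD2⟩
  · rw [Finset.disjoint_union_left]
    exact ⟨hUW, hU2W⟩
  · intro x hx
    rcases Finset.mem_insert.1 hx with rfl | hx
    · exact hj
    · exact h.hJ hx
  · rw [Finset.card_insert_of_notMem hjJ, h.hJc]

/-- State together with remaining path. -/
def StR (col : Finset V → Bool) (b : Bool) (W W' : Finset V) (v0 u' : V) (D1 : Finset V)
    (s k : ℕ) : Prop :=
  ∃ P w u U J D R, St col b W W' v0 u' D1 s P w u U J D ∧ LPath col b w v0 R k ∧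
      (∀ x ∈ R, x ∈ P → x = w) ∧ Disjoint R W

theorem StR.steps {W W' D1 : Finset V} {v0 u' : V} {k : ℕ} (hk : k ≠ 0) (hW : W' ⊆ W) (r : ℕ) :
    ∀ s, StR col b W W' v0 u' D1 s (k + 2 * r) → ¬ Cyc col b (2 * s + (k + 2 * r) + 1) →
      s + r + 2 < W'.card → StR col b W W' v0 u' D1 (s + r) k := by
  induction r with
  | zero => intro s h _ _; simpa using h
  | succ r ih =>
    intro s h hno hc
    obtain ⟨P, w, u, U, J, D, R, h1, h2, h3, h4⟩ := h
    have := h1.step (k := k + 2 * r) h2 (by omega) h3 h4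
      (by rwa [show 2 * s + (k + 2 * r) + 3 = 2 * s + (k + 2 * (r + 1)) + 1 by ring]) hW (by omega)
    have := ih (s + 1) this
      (by rwa [show 2 * (s + 1) + (k + 2 * r) + 1 = 2 * s + (k + 2 * (r + 1)) + 1 by ring])
      (by omega)
    rwa [show s + (r + 1) = s + 1 + r by ring]

theorem start1 {W R' : Finset V} (W' : Finset V) {w x1 x2 x3 x4 x5 z : V} {k : ℕ}
    (nd : [w, x1, x2, x3, x4, x5].Nodup)
    (hxR : ∀ x ∈ [w, x1, x2, x3, x4, x5], x ∉ R') (hz : LPath col b z w R' k) (hk : k ≠ 0)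
    (c1 : col {w, x1, x2, x3} = b) (c2 : col {x3, x4, x5, z} = b)
    (hxW : ∀ x ∈ [w, x1, x2, x3, x4, x5], x ∉ W) (hRW : Disjoint R' W)
    (hno : ¬ Cyc col b (k + 3)) :
    (∃ u' D1, D1.card ≤ 2 ∧ StR col b W W' w u' D1 1 k) ∨
    ((W.filter (fun y => col (insert y {w, x1, x2}) = b)).card ≤ 1 ∧
      ¬ (W.filter (fun y => col (insert y {x3, x4, x5}) = b)).card ≤ 1) := by
  have hzR := hz.mem_start hk
  have hzW : z ∉ W := Finset.disjoint_left.1 hRW hzR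
  have ndw : [w, x1, x2, x3, x4, x5, z].Nodup := by
    have e : [w, x1, x2, x3, x4, x5, z] = [w, x1, x2, x3, x4, x5] ++ [z] := rfl
    rw [e, List.nodup_append]
    refine ⟨nd, by simp, ?_⟩
    intro x hx y hy
    rw [List.mem_singleton] at hy
    rw [hy]
    rintro rfl
    exact hxR _ hx hzR
  have hcase : ∀ x ∈ [w, x1, x2, x3, x4, x5, z], x ∈ [w, x1, x2, x3, x4, x5] ∨ x = z := by
    intro x hx
    simp only [List.mem_cons, List.not_mem_nil, or_false, or_assoc] at hx ⊢
    exact hx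
  have hXW : ∀ x ∈ [w, x1, x2, x3, x4, x5, z], x ∉ W := by
    intro x hx
    rcases hcase x hx with hx | rfl
    · exact hxW x hx
    · exact hzW
  obtain ⟨hi, hw7, ht⟩ := window (col := col) (b := b) (W := W) (T := ∅) (R' := R')
    (t := w) (k := 0) ndw hXW (LPath.nil _) hz (by simp) (by simp) hRW (by simp) hxR
    (by rw [Nat.zero_add]) hno
  rcases winS hi hw7 ht with ⟨U, D, u', u, hU, hu', hu'U, hu, huU, hD, hB⟩ | hh
  · left
    have te := fun s e => two_edges (s := s) (e := e) ndw c1 c2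
    refine ⟨u', D, hD, {w, x1, x2, x3, x4, x5, z}, z, u, U, ∅, D, R',
      ⟨te _ _ (by simp) (by simp), te _ _ (by simp) hu, te _ _ hu' (by simp), te _ _ hu' hu,
      by simp, ?_, ?_, hU, huU, hu'U, by simp, by simp, hD, hD, hB⟩, hz, ?_, hRW⟩
    · rcases hu with rfl | rfl | rfl <;> simp
    · rw [Finset.disjoint_left]
      intro x hx
      exact hXW x (by simpa using hx)
    · intro x hx hx2
      rcases hcase x (by simpa using hx2) with hx3 | rfl
      · exact absurd hx (hxR x hx3)
      · rfl
  · exact Or.inr hh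

theorem start {W S : Finset V} (W' : Finset V) {v : V} {k : ℕ} (h : LPath col b v v S (k + 2))
    (hk : k ≠ 0) (hSW : Disjoint S W) (hno : ¬ Cyc col b (k + 3)) :
    ∃ v0 u' D1, D1.card ≤ 2 ∧ StR col b W W' v0 u' D1 1 k := by
  obtain ⟨x1, x2, x3, x4, x5, z, R', hz, nd, hxR, c1, c2, rfl⟩ := h.inv2
  rw [Finset.disjoint_left] at hSW
  have hxW : ∀ x ∈ [v, x1, x2, x3, x4, x5], x ∉ W := by
    intro x hx
    refine hSW ?_
    rw [Finset.mem_union]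
    left
    simpa using hx
  have hRW : Disjoint R' W := Finset.disjoint_left.2 fun x hx => hSW (by simp [hx])
  rcases start1 W' nd hxR hz hk c1 c2 hxW hRW hno with ⟨u', D1, hh⟩ | hh
  · exact ⟨_, _, _, hh⟩
  obtain ⟨k, rfl⟩ := Nat.exists_eq_succ_of_ne_zero hk
  obtain ⟨y1, y2, y3, R2, hy, a1, a2, a3, a4, a5, a6, a7, rfl⟩ := hz.inv
  simp only [List.mem_cons, List.not_mem_nil, or_false, forall_eq_or_imp, forall_eq,
    List.nodup_cons, not_or, Finset.mem_insert] at nd hxR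
  have hW2 : ∀ x, x ∈ [v, x1, x2, x3, x4, x5] ∨ x ∈ insert z (insert y1 (insert y2 R2)) →
      x ∉ W := by
    rintro x (hx | hx)
    · exact hxW x hx
    · exact Finset.disjoint_left.1 hRW hx
  rcases start1 (w := x3) (x1 := x4) (x2 := x5) (x3 := z) (x4 := y1) (x5 := y2) (z := y3)
    (k := k + 1) (R' := R2 ∪ {v, x1, x2}) (W := W) (col := col) (b := b) W' (by
      simp only [List.nodup_cons, List.mem_cons, List.not_mem_nil, not_or, or_false]
      clear hh hno hy hxW hRW hSW hW2
      grind) (by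
      simp only [List.mem_cons, List.not_mem_nil, or_false, forall_eq_or_imp, forall_eq,
        Finset.mem_insert, Finset.mem_union, Finset.mem_singleton, not_or]
      clear hh hno hy hxW hRW hSW hW2
      grind)
    (hy.append (LPath.edge' nd.1.1 nd.1.2.1 nd.2.1.1 c1) (by
      rw [Finset.disjoint_right]
      simp only [Finset.mem_insert, Finset.mem_singleton, forall_eq_or_imp, forall_eq]
      grind)) hk c2 a7 (by
        intro x hx
        apply hW2
        simp only [List.mem_cons, List.not_mem_nil, or_false, Finset.mem_insert] at hx ⊢
        grind) (by
        rw [Finset.disjoint_left]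
        intro x hx
        apply hW2
        simp only [List.mem_cons, List.not_mem_nil, or_false, Finset.mem_insert, Finset.mem_union,
          Finset.mem_singleton] at hx ⊢
        grind) hno with ⟨u', D1, hh⟩ | hh2
  · exact ⟨_, _, _, hh⟩
  · exact absurd hh2.1 hh.2

end chain2

section final
variable {V : Type*} [DecidableEq V] {col : Finset V → Bool} {b : Bool}

theorem finA_aux {u u' e f y y' z1 z2 z3 : V} {P J : Finset V} {C : Prop}
    (nd : [e, f, y, y', z1, z2, z3].Nodup) (hP : ∀ x ∈ [e, f, y, y', z1, z2, z3], x ∉ P)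
    (hJ : ∀ x ∈ [e, f, z1, z2, z3], x ∉ J) (hu : u ∈ P) (hu' : u' ∈ P)
    (hN : ∀ i p c j q, [i, p, c, j, q].Nodup → (∀ x ∈ [i, p, c, j, q], x ∉ P) →
      col {u, i, p, c} = b → col {c, j, q, u'} = b → False)
    (fin : ∀ i p c j q, [y', i, p, c, j, q].Nodup → (∀ x ∈ [i, p, j, q], x ∉ P) →
      (∀ x ∈ [i, p, j, q], x ≠ y) → (∀ x ∈ [i, p, j, q], x ∉ J) → (c = u ∨ c = u') →
      col {y', i, p, c} = !b → col {c, j, q, y} = !b → C) : C := by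
  have bn : ∀ X, col X ≠ b → col X = !b := by
    intro X; cases col X <;> cases b <;> simp
  have sw1 : ∀ a b c d : V, ({a, b, c, d} : Finset V) = {d, b, c, a} := by
    intro a b c d; ext x; simp only [Finset.mem_insert, Finset.mem_singleton]; tauto
  have sw2 : ∀ a b c d : V, ({a, b, c, d} : Finset V) = {b, a, c, d} := by
    intro a b c d; ext x; simp only [Finset.mem_insert, Finset.mem_singleton]; tauto
  have sw3 : ∀ a b c d : V, ({a, b, c, d} : Finset V) = {a, c, b, d} := by
    intro a b c d; ext x; simp only [Finset.mem_insert, Finset.mem_singleton]; tauto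
  have sw4 : ∀ a b c d : V, ({a, b, c, d} : Finset V) = {b, c, d, a} := by
    intro a b c d; ext x; simp only [Finset.mem_insert, Finset.mem_singleton]; tauto
  have F : ∀ i p c j q, [y, y', i, p, j, q].Nodup → (∀ x ∈ [y', i, p, j, q], x ∉ P) →
      (∀ x ∈ [i, p, j, q], x ∉ J) → (c = u ∨ c = u') →
      col {y', i, p, c} = !b → col {c, j, q, y} = !b → C := by
    intro i p c j q g1 g2 g3 g4 g5 g6
    have hcP : c ∈ P := by rcases g4 with rfl | rfl <;> assumption
    have hc : ∀ x ∈ [y', i, p, j, q], x ≠ c := fun x hx hh => g2 x hx (hh ▸ hcP)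
    refine fin i p c j q ?_ ?_ ?_ g3 g4 g5 g6
    · clear hN fin bn sw1 sw2 sw3 sw4 nd hP hJ g2 g3 g4 g5 g6
      simp only [List.nodup_cons, List.mem_cons, List.not_mem_nil, not_or, or_false,
        forall_eq_or_imp, forall_eq] at g1 hc ⊢
      grind
    · intro x hx; exact g2 x (List.mem_cons_of_mem _ hx)
    · rintro x hx rfl
      exact (List.nodup_cons.1 g1).1 (List.mem_cons_of_mem _ hx)
  clear fin
  simp only [List.nodup_cons, List.mem_cons, List.not_mem_nil, not_or, or_false,
        forall_eq_or_imp, forall_eq, List.nodup_nil, not_false_eq_true, and_true] at nd hP hJ hN F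
  obtain ⟨⟨n1, n2, n3, n4, n5, n6⟩, ⟨n7, n8, n9, n10, n11⟩, ⟨n12, n13, n14, n15⟩, ⟨n16, n17, n18⟩, ⟨n19, n20⟩, n21⟩ := nd
  obtain ⟨p1, p2, p3, p4, p5, p6, p7⟩ := hP
  obtain ⟨j1, j2, j3, j4, j5⟩ := hJ
  by_cases d1 : col {u', e, f, y} = b
  · have e1 := bn _ (fun hh => hN z1 z2 y e f (by simp [*, Ne.symm, eq_comm]; try grind) (by simp [*]) hh
      (by rw [sw1, d1]))
    have e2 := bn _ (fun hh => hN y' z3 e y f (by simp [*]; try grind) (by simp [*]) hh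
      (by rw [← d1, sw1 u', sw2 y]))
    exact F z3 e u z1 z2 (by simp [*]; try grind) (by simp [*]) (by simp [*])
      (Or.inl rfl) (by rw [← sw4, e2]) e1
  by_cases d2 : col {y', z1, z2, u'} = b
  · have e1 := bn _ (fun hh => hN e f y' z1 z2 (by simp [*]; try grind) (by simp [*]) hh d2)
    have e2 := bn _ (fun hh => hN y z3 z1 y' z2 (by simp [*]; try grind) (by simp [*]) hh
      (by rw [sw2, d2]))
    exact F e f u z1 z3 (by simp [*]; try grind) (by simp [*]) (by simp [*])
      (Or.inl rfl) (by rw [sw1, e1]) (by rw [sw3 u z1, ← e2, sw4 u y, sw1 y z3])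
  · exact F z1 z2 u' e f (by simp [*]; try grind) (by simp [*]) (by simp [*])
      (Or.inr rfl) (bn _ d2) (bn _ d1)

theorem St.finalA {W W' D1 P U J D R : Finset V} {v0 u' w u : V} {s : ℕ}
    (h : St col b W W' v0 u' D1 s P w u U J D) (hR : LPath col b w v0 R 1)
    (hRP : ∀ x ∈ R, x ∈ P → x = w) (hRW : Disjoint R W) (hno : ¬ Cyc col b (2 * s + 2))
    (hW : W' ⊆ W) (hc : s + 4 ≤ W.card) : Cyc col (!b) (2 * s + 2) := by
  obtain ⟨e, f, z, T, hz, a1, a2, a3, a4, a5, a6, c1, rfl⟩ := LPath.inv (n := 0) hR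
  clear hz a4 a5 a6
  have hRW' := Finset.disjoint_left.1 hRW
  have hPW := Finset.disjoint_left.1 h.hPW
  have hu := h.hu
  have huP := h.p4.mem_start (by have := h.hJc; omega)
  rw [Finset.mem_erase] at huP
  have heP : e ∉ P := fun hh => a1 (hRP e (by simp) hh).symm
  have hfP : f ∉ P := fun hh => a2 (hRP f (by simp) hh).symm
  have heW : e ∉ W := hRW' (by simp)
  have hfW : f ∉ W := hRW' (by simp)
  have hJW : ∀ x ∈ J, x ∈ W := fun x hx => hW (h.hJ hx)
  have hJc := h.hJc
  have hD := h.hD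
  have hD1 := h.hD1
  obtain ⟨y, hy, hy'⟩ := Finset.exists_mem_notMem_of_card_lt_card (s := D1 ∪ J) (t := W)
    (by have := Finset.card_union_le D1 J; omega)
  obtain ⟨y', hyy, hyy'⟩ := Finset.exists_mem_notMem_of_card_lt_card (s := insert y (D ∪ J)) (t := W)
    (by have := Finset.card_union_le D J; have := Finset.card_insert_le y (D ∪ J); omega)
  have h3 : 3 ≤ (W \ (insert y (insert y' J))).card := by
    have := Finset.le_card_sdiff (insert y (insert y' J)) W
    have := Finset.card_insert_le y (insert y' J)
    have := Finset.card_insert_le y' J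
    omega
  obtain ⟨Z, hZ, hZc⟩ := Finset.exists_subset_card_eq h3
  obtain ⟨z1, z2, z3, z12, z13, z23, rfl⟩ := Finset.card_eq_three.1 hZc
  have m1 := Finset.mem_sdiff.1 (hZ (show z1 ∈ _ by simp))
  have m2 := Finset.mem_sdiff.1 (hZ (show z2 ∈ _ by simp))
  have m3 := Finset.mem_sdiff.1 (hZ (show z3 ∈ _ by simp))
  simp only [Finset.mem_union, not_or, Finset.mem_insert] at hy' hyy' m1 m2 m3
  have hWP : ∀ x ∈ W, x ∉ P := fun x hx hh => hPW hh hx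
  have hN : ∀ i p c j q, [i, p, c, j, q].Nodup → (∀ x ∈ [i, p, c, j, q], x ∉ P) →
      col {u, i, p, c} = b → col {c, j, q, u'} = b → False := by
    intro i p c j q nd hP d1 d2
    apply hno
    have nd' : [u, i, p, c, j, q].Nodup := List.nodup_cons.2 ⟨fun hh => hP u hh hu, nd⟩
    refine ⟨u', _, h.p4.append (path2 nd' d1 d2) ?_⟩
    rw [Finset.disjoint_right]
    intro x hx
    rcases Finset.mem_insert.1 hx with rfl | hx
    · simp
    · exact fun hh => hP x (by simpa using hx) (Finset.mem_of_mem_erase hh)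
  have fin : ∀ i p c j q, [y', i, p, c, j, q].Nodup → (∀ x ∈ [i, p, j, q], x ∉ P) →
      (∀ x ∈ [i, p, j, q], x ≠ y) → (∀ x ∈ [i, p, j, q], x ∉ J) → (c = u ∨ c = u') →
      col {y', i, p, c} = !b → col {c, j, q, y} = !b → Cyc col (!b) (2 * s + 2) := by
    intro i p c j q nd g1 g2 g3 g4 d1 d2
    refine ⟨y, _, (h.blue y hy hy'.1 hy'.2 y' hyy hyy'.2.1 hyy'.2.2).append (path2 nd d1 d2) ?_⟩
    have hcP : c ∈ P := by rcases g4 with rfl | rfl; exacts [hu, huP.2]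
    have hcU : c ∉ U := by rcases g4 with rfl | rfl; exacts [h.huU, h.huU']
    have hUP : ∀ x, x ∉ P → x ∉ U := fun x hx hh => hx (h.hUP hh)
    rw [Finset.disjoint_right]
    intro x hx
    rw [Finset.mem_insert, Finset.mem_union, not_or, not_or]
    have hx : x = y' ∨ x = c ∨ x ∈ [i, p, j, q] := by
      simp only [Finset.mem_insert, Finset.mem_singleton, List.mem_cons, List.not_mem_nil,
        or_false] at hx ⊢
      clear * - hx
      tauto
    rcases hx with rfl | rfl | hx
    · exact ⟨hyy'.1, hUP _ (hWP _ hyy), hyy'.2.2⟩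
    · exact ⟨fun hh => hPW hcP (hh ▸ hy), hcU, fun hh => hPW hcP (hJW _ hh)⟩
    · exact ⟨g2 x hx, hUP _ (g1 x hx), g3 x hx⟩
  have ne1 : ∀ x ∈ W, e ≠ x ∧ f ≠ x :=
    fun x hx => ⟨fun hh => heW (hh ▸ hx), fun hh => hfW (hh ▸ hx)⟩
  refine finA_aux (e := e) (f := f) (z1 := z1) (z2 := z2) (z3 := z3) (y := y) (y' := y')
    (P := P) (J := J) (u := u) (u' := u') (col := col) (b := b) ?_ ?_ ?_ hu huP.2 hN fin
  · have n1 := ne1 y hy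
    have n2 := ne1 y' hyy
    have n3 := ne1 z1 m1.1
    have n4 := ne1 z2 m2.1
    have n5 := ne1 z3 m3.1
    have m1 := m1.2
    have m2 := m2.2
    have m3 := m3.2
    simp only [List.nodup_cons, List.mem_cons, List.not_mem_nil, not_or, or_false,
      List.nodup_nil, not_false_eq_true, and_true]
    exact ⟨⟨a3, n1.1, n2.1, n3.1, n4.1, n5.1⟩, ⟨n1.2, n2.2, n3.2, n4.2, n5.2⟩,
      ⟨Ne.symm hyy'.1, Ne.symm m1.1, Ne.symm m2.1, Ne.symm m3.1⟩,
      ⟨Ne.symm m1.2.1, Ne.symm m2.2.1, Ne.symm m3.2.1⟩, ⟨z12, z13⟩, z23⟩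
  · simp only [List.mem_cons, List.not_mem_nil, or_false, forall_eq_or_imp, forall_eq]
    exact ⟨heP, hfP, hWP _ hy, hWP _ hyy, hWP _ m1.1, hWP _ m2.1, hWP _ m3.1⟩
  · simp only [List.mem_cons, List.not_mem_nil, or_false, forall_eq_or_imp, forall_eq]
    exact ⟨fun hh => heW (hJW _ hh), fun hh => hfW (hJW _ hh), m1.2.2.2, m2.2.2.2, m3.2.2.2⟩

theorem stepA [Fintype V] {t : ℕ} (ht : 1 ≤ t) (hV : 7 * (t + 1) ≤ Fintype.card V)
    (h : Cyc col b (2 * t + 1)) : Cyc col b (2 * t + 2) ∨ Cyc col (!b) (2 * t + 2) := by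
  by_cases hno : Cyc col b (2 * t + 2)
  · exact Or.inl hno
  right
  obtain ⟨v, S, h⟩ := h
  have hSc := h.card
  have hWc : t + 4 ≤ Sᶜ.card := by
    rw [Finset.card_compl]; omega
  obtain ⟨r, rfl⟩ : ∃ r, t = r + 1 := ⟨t - 1, by omega⟩
  obtain ⟨v0, u', D1, hD1, hst⟩ := start (W := Sᶜ) (k := 1 + 2 * r) Sᶜ
    (by rwa [show 1 + 2 * r + 2 = 2 * (r + 1) + 1 by ring]) (by omega) disjoint_compl_right
    (by rwa [show 1 + 2 * r + 3 = 2 * (r + 1) + 2 by ring])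
  have := StR.steps (by omega) subset_rfl r 1 hst
    (by rwa [show 2 * 1 + (1 + 2 * r) + 1 = 2 * (r + 1) + 2 by ring]) (by omega)
  rw [Nat.add_comm] at this
  obtain ⟨P, w, u, U, J, D, R, h1, h2, h3, h4⟩ := this
  exact h1.finalA h2 h3 h4 hno subset_rfl hWc

theorem fullchain {t : ℕ} (ht : 2 ≤ t) {v : V} {S W W' : Finset V} (h : LPath col b v v S (2 * t))
    (hno : ¬ Cyc col b (2 * t + 1)) (hSW : Disjoint S W) (hW : W' ⊆ W) (hc : t + 2 < W'.card) :
    ∃ D1 D U J, D1.card ≤ 2 ∧ D.card ≤ 2 ∧ BChain col (!b) W D1 D U J (2 * t) ∧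
      Disjoint U W ∧ J ⊆ W' ∧ J.card + 1 = t := by
  obtain ⟨r, rfl⟩ : ∃ r, t = r + 2 := ⟨t - 2, by omega⟩
  obtain ⟨v0, u', D1, hD1, hst⟩ := start (W := W) (k := 2 + 2 * r) W'
    (by rwa [show 2 + 2 * r + 2 = 2 * (r + 2) by ring]) (by omega) hSW
    (by rwa [show 2 + 2 * r + 3 = 2 * (r + 2) + 1 by ring])
  have := StR.steps (by omega) hW r 1 hst
    (by rwa [show 2 * 1 + (2 + 2 * r) + 1 = 2 * (r + 2) + 1 by ring]) (by omega)
  rw [Nat.add_comm] at this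
  obtain ⟨P, w, u, U, J, D, R, h1, h2, h3, h4⟩ := this
  obtain ⟨U, J, D, a1, a2, a3, a4, a5⟩ := h1.last h2 h3 h4
    (by rwa [show 2 * (r + 1) + 3 = 2 * (r + 2) + 1 by ring]) hW (by omega)
  exact ⟨D1, D, U, J, hD1, a5, a1, a2, a3, by omega⟩

theorem stepQ [Fintype V] {t : ℕ} (ht : 2 ≤ t) (hV : 7 * (t + 1) ≤ Fintype.card V) {v : V}
    {S Q : Finset V} (h : LPath col b v v S (2 * t)) (hQ : Q.card = 4) (hQS : Disjoint Q S)
    (hQc : col Q = !b) : Cyc col b (2 * t + 1) ∨ Cyc col (!b) (2 * t + 1) := by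
  by_cases hno : Cyc col b (2 * t + 1)
  · exact Or.inl hno
  right
  have hSc := h.card
  have hQW : Q ⊆ Sᶜ := fun x hx => Finset.mem_compl.2 (Finset.disjoint_left.1 hQS hx)
  obtain ⟨D1, D, U, J, hD1, hD, hB, hU, hJ, hJc⟩ := fullchain (W := Sᶜ) (W' := Sᶜ \ Q) ht h hno
    disjoint_compl_right Finset.sdiff_subset (by
      rw [Finset.card_sdiff_of_subset hQW, Finset.card_compl]; omega)
  obtain ⟨y, hy, hy'⟩ := Finset.exists_mem_notMem_of_card_lt_card (s := D1) (t := Q) (by omega)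
  obtain ⟨y', hyy, hyy'⟩ := Finset.exists_mem_notMem_of_card_lt_card (s := insert y D) (t := Q)
    (by have := Finset.card_insert_le y D; omega)
  simp only [Finset.mem_insert, not_or] at hyy'
  have hJQ : ∀ x ∈ Q, x ∉ J := fun x hx hh => (Finset.mem_sdiff.1 (hJ hh)).2 hx
  have hUQ : ∀ x ∈ Q, x ∉ U := fun x hx hh => Finset.disjoint_left.1 hU hh (hQW hx)
  refine ⟨y, _, (hB y (hQW hy) hy' (hJQ _ hy) y' (hQW hyy) hyy'.2 (hJQ _ hyy)).append
    (LPath.edge hQ hyy hy hyy'.1 hQc) ?_⟩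
  rw [Finset.disjoint_right]
  intro x hx
  rw [Finset.mem_erase] at hx
  simp only [Finset.mem_insert, Finset.mem_union, not_or]
  exact ⟨hx.1, hUQ x hx.2, hJQ x hx.2⟩

theorem stepB [Fintype V] {t : ℕ} (ht : 2 ≤ t) (hV : 7 * (t + 1) ≤ Fintype.card V)
    (h : Cyc col b (2 * t)) : Cyc col b (2 * t + 1) ∨ Cyc col (!b) (2 * t + 1) := by
  by_cases hno : Cyc col b (2 * t + 1)
  · exact Or.inl hno
  obtain ⟨v, S, h⟩ := h
  have hSc := h.card
  by_cases hex : ∃ Q : Finset V, Q.card = 4 ∧ Disjoint Q S ∧ col Q = !b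
  · obtain ⟨Q, h1, h2, h3⟩ := hex
    exact stepQ ht hV h h1 h2 h3
  have hWc : t + 7 ≤ Sᶜ.card := by rw [Finset.card_compl]; omega
  obtain ⟨D1, D, U, J, hD1, hD, hB, hU, hJ, hJc⟩ := fullchain (W := Sᶜ) (W' := Sᶜ) ht h hno
    disjoint_compl_right subset_rfl (by omega)
  obtain ⟨y, hy, hy'⟩ := Finset.exists_mem_notMem_of_card_lt_card (s := (D1 ∪ D) ∪ J) (t := Sᶜ)
    (by
      have := Finset.card_union_le (D1 ∪ D) J
      have := Finset.card_union_le D1 D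
      omega)
  simp only [Finset.mem_union, not_or] at hy'
  have hcy := hB y hy hy'.1.1 hy'.2 y hy hy'.1.2 hy'.2
  have h4 : 4 ≤ (Sᶜ \ insert y J).card := by
    have := Finset.le_card_sdiff (insert y J) Sᶜ
    have := Finset.card_insert_le y J
    omega
  obtain ⟨Q, hQ, hQc⟩ := Finset.exists_subset_card_eq h4
  have hQ1 : ∀ x ∈ Q, x ∈ Sᶜ ∧ x ∉ insert y J := fun x hx => Finset.mem_sdiff.1 (hQ hx)
  have hQb : col Q = b := by
    by_contra hne
    refine hex ⟨Q, hQc, Finset.disjoint_left.2 fun x hx => Finset.mem_compl.1 (hQ1 x hx).1, ?_⟩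
    revert hne
    cases col Q <;> cases b <;> simp
  have := stepQ ht hV hcy hQc (Finset.disjoint_left.2 fun x hx hh => by
    have h1 := hQ1 x hx
    have h2 : x ∉ U := fun h3 => Finset.disjoint_left.1 hU h3 h1.1
    simp only [Finset.mem_insert, Finset.mem_union, not_or] at h1 hh
    tauto) (by simpa using hQb)
  rw [Bool.not_not] at this
  exact this.symm

end final

section base
variable {V : Type*} [DecidableEq V] {col : Finset V → Bool}

theorem cyc3 {b : Bool} {x p q y r s z t u : V} (hn : [x, p, q, y, r, s, z, t, u].Nodup)
    (h1 : col {x, p, q, y} = b) (h2 : col {y, r, s, z} = b) (h3 : col {z, t, u, x} = b) :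
    Cyc col b 3 := by
  have nd1 : [x, p, q, y, r, s].Nodup := by
    refine hn.sublist ?_
    exact List.sublist_append_left [x, p, q, y, r, s] [z, t, u]
  simp only [List.nodup_cons, List.mem_cons, List.not_mem_nil, not_or, or_false] at hn
  refine ⟨x, _, (path2 nd1 h1 h2).append (LPath.edge' ?_ ?_ ?_ h3) ?_⟩
  · tauto
  · tauto
  · tauto
  · simp only [Finset.disjoint_left, Finset.mem_insert, Finset.mem_singleton]
    grind

def cntM (col : Finset V → Bool) {k : ℕ} (M : Fin k → V × V) (b : Bool) (x y : V) :
    Finset (Fin k) :=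
  Finset.univ.filter fun c => col {x, (M c).1, (M c).2, y} = b

theorem cntM_symm {k : ℕ} (M : Fin k → V × V) (b : Bool) (x y : V) :
    cntM col M b x y = cntM col M b y x := by
  unfold cntM
  congr 1
  ext c
  rw [show ({x, (M c).1, (M c).2, y} : Finset V) = {y, (M c).1, (M c).2, x} by
    ext; simp only [Finset.mem_insert, Finset.mem_singleton]; tauto]

theorem cntM_compl {k : ℕ} (M : Fin k → V × V) (b : Bool) (x y : V) :
    (cntM col M b x y).card + (cntM col M (!b) x y).card = k := by
  unfold cntM
  have h := Finset.card_filter_add_card_filter_not (s := (Finset.univ : Finset (Fin k)))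
    (fun c => col {x, (M c).1, (M c).2, y} = b)
  simp only [Finset.card_univ, Fintype.card_fin] at h
  refine Eq.trans ?_ h
  congr 2
  ext c
  simp only [Finset.mem_filter]
  cases col {x, (M c).1, (M c).2, y} <;> cases b <;> simp

theorem triple {M : Fin 5 → V × V} {x y z : V}
    (hM : ∀ i j k, i ≠ j → j ≠ k → i ≠ k →
      [x, (M i).1, (M i).2, y, (M j).1, (M j).2, z, (M k).1, (M k).2].Nodup)
    (hno : ∀ b, ¬ Cyc col b 3) (b : Bool) :
    (cntM col M b x y).card ≤ 1 ∨ (cntM col M b y z).card ≤ 1 ∨ (cntM col M b z x).card ≤ 1 := by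
  have key : ∀ b, ∀ w1 ∈ cntM col M b x y, ∀ w2 ∈ cntM col M b y z, ∀ w3 ∈ cntM col M b z x,
      w1 ≠ w2 → w2 ≠ w3 → w1 ≠ w3 → False := by
    intro b w1 h1 w2 h2 w3 h3 n1 n2 n3
    simp only [cntM, Finset.mem_filter] at h1 h2 h3
    exact hno b (cyc3 (hM w1 w2 w3 n1 n2 n3) h1.2 h2.2 h3.2)
  by_contra! hh
  obtain ⟨h1, h2, h3⟩ := hh
  obtain ⟨e1, e2, e3⟩ := hall3 (key b) h1 h2 h3
  have c1 := cntM_compl (col := col) M b x y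
  have c2 := cntM_compl (col := col) M b y z
  have c3 := cntM_compl (col := col) M b z x
  rw [e1] at c1
  rw [← e2] at c3
  obtain ⟨f1, f2, f3⟩ := hall3 (key (!b)) (by omega) (by omega) (by omega)
  omega

theorem cnt_mono (p : V × V) (N : Fin 4 → V × V) (b : Bool) (x y : V) :
    (cntM col N b x y).card ≤ (cntM col (Fin.cons p N : Fin 5 → V × V) b x y).card := by
  rw [← Finset.card_map (Fin.succEmb 4)]
  apply Finset.card_le_card
  intro c hc
  simp only [Finset.mem_map, cntM, Finset.mem_filter] at hc ⊢
  obtain ⟨d, hd, rfl⟩ := hc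
  exact ⟨Finset.mem_univ _, by simpa using hd.2⟩

set_option maxHeartbeats 1000000 in
theorem idx_nodup {x y z v w : ℕ} (hd : [x, y, z, v, w].Nodup) (hl : ∀ a ∈ [x, y, z, v, w], a < 6)
    {i j k : ℕ} (h1 : i ≠ j) (h2 : j ≠ k) (h3 : i ≠ k) :
    let A := fun c => if c = 0 then v else 4 + 2 * c
    let B := fun c => if c = 0 then w else 5 + 2 * c
    [x, A i, B i, y, A j, B j, z, A k, B k].Nodup := by
  intro A B
  simp only [List.nodup_cons, List.mem_cons, List.not_mem_nil, not_or, or_false,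
    forall_eq_or_imp, forall_eq, List.nodup_nil, not_false_eq_true, and_true] at hd hl ⊢
  have hA : ∀ c, (c = 0 ∧ A c = v ∧ B c = w) ∨ (1 ≤ c ∧ A c = 4 + 2 * c ∧ B c = 5 + 2 * c) := by
    intro c
    by_cases hc : c = 0
    · left; simp [A, B, hc]
    · right; simp [A, B, hc]; omega
  have k1 := hA i
  have k2 := hA j
  have k3 := hA k
  clear hA
  clear_value A B
  generalize A i = ai at *
  generalize A j = aj at *
  generalize A k = ak at *
  generalize B i = bi at *
  generalize B j = bj at *
  generalize B k = bk at *
  clear A B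
  refine ⟨⟨?_, ?_, ?_, ?_, ?_, ?_, ?_, ?_⟩, ⟨?_, ?_, ?_, ?_, ?_, ?_, ?_⟩, ⟨?_, ?_, ?_, ?_, ?_, ?_⟩,
    ⟨?_, ?_, ?_, ?_, ?_⟩, ⟨?_, ?_, ?_, ?_⟩, ⟨?_, ?_, ?_⟩, ⟨?_, ?_⟩, ?_⟩ <;> omega

theorem base3 [Fintype V] (hV : 14 ≤ Fintype.card V) (col : Finset V → Bool) :
    ∃ b, Cyc col b 3 := by
  by_contra! hno
  obtain ⟨g, hg⟩ : ∃ g : ℕ → V, ∀ i < 14, ∀ j < 14, g i = g j → i = j := by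
    obtain ⟨e⟩ := Function.Embedding.nonempty_of_card_le (α := Fin 14) (β := V) (by simpa using hV)
    refine ⟨fun i => if h : i < 14 then e ⟨i, h⟩ else e 0, ?_⟩
    intro i hi j hj h
    simpa [hi, hj] using h
  let N : Fin 4 → V × V := fun c => (g (6 + 2 * c.val), g (7 + 2 * c.val))
  have T : ∀ x y z v w, [x, y, z, v, w].Nodup → (∀ a ∈ [x, y, z, v, w], a < 6) → ∀ b,
      (cntM col N b (g x) (g y)).card ≤ 1 ∨ (cntM col N b (g y) (g z)).card ≤ 1 ∨
      (cntM col N b (g x) (g z)).card ≤ 1 := by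
    intro x y z v w hd hl b
    have := triple (col := col) (M := Fin.cons (g v, g w) N) (x := g x) (y := g y) (z := g z)
      (by
        intro i j k n1 n2 n3
        have hM : ∀ c : Fin 5, (Fin.cons (g v, g w) N : Fin 5 → V × V) c =
            (g (if c.val = 0 then v else 4 + 2 * c.val),
              g (if c.val = 0 then w else 5 + 2 * c.val)) := by
          intro c
          refine Fin.cases ?_ (fun d => ?_) c
          · simp
          · simp only [Fin.cons_succ, N, Fin.val_succ, Nat.add_eq_zero_iff, one_ne_zero, and_false,
              if_false]
            rw [show 4 + 2 * (d.val + 1) = 6 + 2 * d.val by ring,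
              show 5 + 2 * (d.val + 1) = 7 + 2 * d.val by ring]
        rw [hM, hM, hM]
        have nd := idx_nodup hd hl (i := i.val) (j := j.val) (k := k.val) (by omega) (by omega)
          (by omega)
        refine nd.map_on (f := g) ?_
        have hb : ∀ a ∈ [x, if i.val = 0 then v else 4 + 2 * i.val, if i.val = 0 then w else 5 + 2 * i.val,
            y, if j.val = 0 then v else 4 + 2 * j.val, if j.val = 0 then w else 5 + 2 * j.val,
            z, if k.val = 0 then v else 4 + 2 * k.val, if k.val = 0 then w else 5 + 2 * k.val],
            a < 14 := by
          simp only [List.mem_cons, List.not_mem_nil, or_false, forall_eq_or_imp, forall_eq] at hl ⊢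
          have := i.isLt
          have := j.isLt
          have := k.isLt
          refine ⟨?_, ?_, ?_, ?_, ?_, ?_, ?_, ?_, ?_⟩ <;> first | omega | (split_ifs <;> omega)
        intro a ha c hc hac
        exact hg a (hb a ha) c (hb c hc) hac)
      hno b
    have m1 := cnt_mono (col := col) (g v, g w) N b (g x) (g y)
    have m2 := cnt_mono (col := col) (g v, g w) N b (g y) (g z)
    have m3 := cnt_mono (col := col) (g v, g w) N b (g z) (g x)
    rw [cntM_symm N b (g z)] at m3
    omega
  have T2 : ∀ x y z v w, [x, y, z, v, w].Nodup → (∀ a ∈ [x, y, z, v, w], a < 6) →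
      ((cntM col N true (g x) (g y)).card ≤ 1 ∨ (cntM col N true (g y) (g z)).card ≤ 1 ∨
      (cntM col N true (g x) (g z)).card ≤ 1) ∧
      (¬ (cntM col N true (g x) (g y)).card ≤ 1 ∨ ¬ (cntM col N true (g y) (g z)).card ≤ 1 ∨
      ¬ (cntM col N true (g x) (g z)).card ≤ 1) := by
    intro x y z v w hd hl
    refine ⟨T x y z v w hd hl true, ?_⟩
    have h := T x y z v w hd hl false
    have c1 := cntM_compl (col := col) N true (g x) (g y)
    have c2 := cntM_compl (col := col) N true (g y) (g z)
    have c3 := cntM_compl (col := col) N true (g x) (g z)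
    simp only [Bool.not_true] at c1 c2 c3
    omega
  generalize hP : (fun x y : ℕ => (cntM col N true (g x) (g y)).card ≤ 1) = P
  have T3 : ∀ x y z v w, [x, y, z, v, w].Nodup → (∀ a ∈ [x, y, z, v, w], a < 6) →
      (P x y ∨ P y z ∨ P x z) ∧ (¬ P x y ∨ ¬ P y z ∨ ¬ P x z) := by
    subst hP
    exact T2
  clear T T2 hP
  have t012 := T3 0 1 2 3 4 (by decide) (by decide)
  have t013 := T3 0 1 3 2 4 (by decide) (by decide)
  have t014 := T3 0 1 4 2 3 (by decide) (by decide)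
  have t015 := T3 0 1 5 2 3 (by decide) (by decide)
  have t023 := T3 0 2 3 1 4 (by decide) (by decide)
  have t024 := T3 0 2 4 1 3 (by decide) (by decide)
  have t025 := T3 0 2 5 1 3 (by decide) (by decide)
  have t034 := T3 0 3 4 1 2 (by decide) (by decide)
  have t035 := T3 0 3 5 1 2 (by decide) (by decide)
  have t045 := T3 0 4 5 1 2 (by decide) (by decide)
  have t123 := T3 1 2 3 0 4 (by decide) (by decide)
  have t124 := T3 1 2 4 0 3 (by decide) (by decide)
  have t125 := T3 1 2 5 0 3 (by decide) (by decide)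
  have t134 := T3 1 3 4 0 2 (by decide) (by decide)
  have t135 := T3 1 3 5 0 2 (by decide) (by decide)
  have t145 := T3 1 4 5 0 2 (by decide) (by decide)
  have t234 := T3 2 3 4 0 1 (by decide) (by decide)
  have t235 := T3 2 3 5 0 1 (by decide) (by decide)
  have t245 := T3 2 4 5 0 1 (by decide) (by decide)
  have t345 := T3 3 4 5 0 1 (by decide) (by decide)
  clear T3
  by_cases h1 : P 0 1 <;> by_cases h2 : P 0 2 <;> by_cases h3 : P 0 3 <;> by_cases h4 : P 0 4 <;>
    by_cases h5 : P 0 5 <;> simp only [h1, h2, h3, h4, h5, true_or, or_true, and_true, true_and,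
      not_true_eq_false, not_false_eq_true, false_or, or_false] at * <;> grind

theorem upper_gen [Fintype V] (col : Finset V → Bool) (m : ℕ) (hm : 2 ≤ m)
    (hV : 7 * m ≤ Fintype.card V) : ∃ b, Cyc col b (2 * m) := by
  induction m, hm using Nat.le_induction with
  | base =>
    obtain ⟨b, hb⟩ := base3 (by omega) col
    rcases stepA (t := 1) le_rfl (by omega) hb with h | h
    exacts [⟨_, h⟩, ⟨_, h⟩]
  | succ t ht ih =>
    obtain ⟨b, hb⟩ := ih (by omega)
    have : ∃ b, Cyc col b (2 * t + 1) := by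
      rcases stepB ht hV hb with h | h
      exacts [⟨_, h⟩, ⟨_, h⟩]
    obtain ⟨b, hb⟩ := this
    rcases stepA (by omega) hV hb with h | h
    exacts [⟨_, h⟩, ⟨_, h⟩]

end base

theorem upper_aux (m : ℕ) (hm : 2 ≤ m) (col : Finset (Fin (7 * m)) → Bool) :
    HasLooseCycle 4 (2 * m) col true ∨ HasLooseCycle 4 (2 * m) col false := by
  obtain ⟨b, hb⟩ := upper_gen col m hm (by simp)
  cases b
  · exact Or.inr hb.toHas
  · exact Or.inl hb.toHas

/-- For every even n ≥ 4, 3n + ⌊(n-1)/2⌋ ≤ R(C⁴ₙ, C⁴ₙ) ≤ 3n + ⌊(n-1)/2⌋ + 1. -/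
theorem ramsey_C4n_C4n_even (n : ℕ) (hn : 4 ≤ n) (heven : Even n) :
    3 * n + (n - 1) / 2 ≤ RamseyCC 4 n n ∧
    RamseyCC 4 n n ≤ 3 * n + (n - 1) / 2 + 1 := by
  obtain ⟨m, rfl⟩ := heven
  have hm : 2 ≤ m := by omega
  have e : m + m = 2 * m := by omega
  rw [e]
  have hmem : 7 * m ∈ {N | 0 < N ∧ ∀ col : Finset (Fin N) → Bool,
      HasLooseCycle 4 (2 * m) col true ∨ HasLooseCycle 4 (2 * m) col false} :=
    ⟨by omega, upper_aux m hm⟩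
  constructor
  · have := Nat.sInf_mem ⟨_, hmem⟩
    have h2 := lower_aux m _ hm this.1 this.2
    unfold RamseyCC
    omega
  · have := Nat.sInf_le hmem
    unfold RamseyCC
    omega
end

section
/- Let n and m be integers such that n ≥ m + 1 ≥ 4, or n = m ≥ 3 with n odd. Then the Ramsey number of a 4-uniform loose path versus a 4-uniform loose cycle satisfies R(P^4_n, C^4_m) = 3n + ⌊(m+1)/2⌋. -/
namespace R4

variable {V : Type*} [DecidableEq V]

/-- abstract loose path of color `c` from `x` to `z` with vertex set `S` -/
inductive LP (col : Finset V → Bool) (c : Bool) : ℕ → V → V → Finset V → Prop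
  | nil (x : V) : LP col c 0 x x {x}
  | cons {n : ℕ} {x a b y z : V} {S : Finset V} (he : col {x, a, b, y} = c)
      (h : LP col c n y z S) (hx : x ∉ S) (ha : a ∉ S) (hb : b ∉ S)
      (hxa : x ≠ a) (hxb : x ≠ b) (hab : a ≠ b) :
      LP col c (n + 1) x z (insert x (insert a (insert b S)))

variable {col : Finset V → Bool} {c : Bool}

lemma LP.left_mem {n : ℕ} {x y : V} {S : Finset V} (h : LP col c n x y S) : x ∈ S := by
  cases h <;> simp

lemma LP.right_mem {n : ℕ} {x y : V} {S : Finset V} (h : LP col c n x y S) : y ∈ S := by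
  induction h with
  | nil => simp
  | cons => simp [*]

lemma LP.single {x a b y : V} (he : col {x, a, b, y} = c) (hn : [x, a, b, y].Nodup) :
    LP col c 1 x y {x, a, b, y} := by
  simp at hn
  have := LP.cons (c := c) he (LP.nil (col := col) (c := c) y) (by simp; tauto) (by simp; tauto)
    (by simp; tauto) (by tauto) (by tauto) (by tauto)
  simpa using this

lemma LP.append {n k : ℕ} {x y z : V} {S T : Finset V} (h : LP col c n x y S)
    (h' : LP col c k y z T) (hd : ∀ v ∈ S, v ∈ T → v = y) : LP col c (n + k) x z (S ∪ T) := by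
  induction h with
  | nil x =>
    have : {x} ∪ T = T := by
      rw [Finset.union_eq_right]; simpa using h'.left_mem
    rw [this, Nat.zero_add]; exact h'
  | @cons n x a b y' z' S he h hx ha hb hxa hxb hab ih =>
    have hz := h.right_mem
    have ih' := ih h' (fun v hv hv' => hd v (by simp [hv]) hv')
    have e : insert x (insert a (insert b S)) ∪ T = insert x (insert a (insert b (S ∪ T))) := by
      simp [Finset.insert_union]
    have e2 : n + 1 + k = (n + k) + 1 := by ring
    rw [e, e2]
    refine LP.cons he ih' ?_ ?_ ?_ hxa hxb hab
    · intro hh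
      rcases Finset.mem_union.1 hh with h1 | h1
      · exact hx h1
      · exact hx ((hd x (by simp) h1) ▸ hz)
    · intro hh
      rcases Finset.mem_union.1 hh with h1 | h1
      · exact ha h1
      · exact ha ((hd a (by simp) h1) ▸ hz)
    · intro hh
      rcases Finset.mem_union.1 hh with h1 | h1
      · exact hb h1
      · exact hb ((hd b (by simp) h1) ▸ hz)

lemma LP.snoc {n : ℕ} {x y z a b : V} {S : Finset V} (h : LP col c n x y S)
    (he : col {y, a, b, z} = c) (ha : a ∉ S) (hb : b ∉ S) (hz : z ∉ S)
    (hab : a ≠ b) (haz : a ≠ z) (hbz : b ≠ z) :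
    LP col c (n + 1) x z (S ∪ {y, a, b, z}) := by
  have hy := h.right_mem
  refine h.append (LP.single he ?_) ?_
  · simp
    refine ⟨⟨?_, ?_, ?_⟩, ⟨hab, haz⟩, hbz⟩ <;> rintro rfl <;> contradiction
  · intro v hv hv'
    simp at hv'
    rcases hv' with rfl | rfl | rfl | rfl
    · rfl
    all_goals contradiction

lemma LP.exists_fun {n : ℕ} {x y : V} {S : Finset V} (h : LP col c n x y S) :
    ∃ f : ℕ → V, f 0 = x ∧ f (3 * n) = y ∧ (∀ i ≤ 3 * n, f i ∈ S) ∧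
      (∀ i j, i ≤ 3 * n → j ≤ 3 * n → f i = f j → i = j) ∧
      ∀ i < n, col {f (3 * i), f (3 * i + 1), f (3 * i + 2), f (3 * i + 3)} = c := by
  induction h with
  | nil x => exact ⟨fun _ => x, rfl, rfl, by simp, by intros; omega, by simp⟩
  | @cons n x a b y z S he h hx ha hb hxa hxb hab ih =>
    obtain ⟨f, h0, h1, h2, h3, h4⟩ := ih
    let g : ℕ → V := fun i => match i with
      | 0 => x
      | 1 => a
      | 2 => b
      | (i + 3) => f i
    refine ⟨g, rfl, h1, ?_, ?_, ?_⟩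
    · intro i hi
      match i with
      | 0 => simp [g]
      | 1 => simp [g]
      | 2 => simp [g]
      | (i + 3) =>
        have := h2 i (by omega)
        simp [g, this]
    · intro i j hi hj hij
      match i, j with
      | 0, 0 => rfl
      | 0, 1 => exact absurd hij hxa
      | 0, 2 => exact absurd hij hxb
      | 0, (j + 3) =>
        have hij : x = f j := hij
        exact absurd (hij ▸ h2 j (by omega)) hx
      | 1, 0 => exact absurd hij.symm hxa
      | 1, 1 => rfl
      | 1, 2 => exact absurd hij hab
      | 1, (j + 3) =>
        have hij : a = f j := hij
        exact absurd (hij ▸ h2 j (by omega)) ha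
      | 2, 0 => exact absurd hij.symm hxb
      | 2, 1 => exact absurd hij.symm hab
      | 2, 2 => rfl
      | 2, (j + 3) =>
        have hij : b = f j := hij
        exact absurd (hij ▸ h2 j (by omega)) hb
      | (i + 3), 0 =>
        have hij : f i = x := hij
        exact absurd (hij ▸ h2 i (by omega)) hx
      | (i + 3), 1 =>
        have hij : f i = a := hij
        exact absurd (hij ▸ h2 i (by omega)) ha
      | (i + 3), 2 =>
        have hij : f i = b := hij
        exact absurd (hij ▸ h2 i (by omega)) hb
      | (i + 3), (j + 3) =>
        have := h3 i j (by omega) (by omega) hij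
        omega
    · intro i hi
      match i with
      | 0 => simpa [g, h0] using he
      | (i + 1) => exact h4 i (by omega)

lemma img4 (g : ℕ → V) : (Finset.range 4).image g = {g 0, g 1, g 2, g 3} := by
  have : Finset.range 4 = {0, 1, 2, 3} := by decide
  rw [this]; simp [Finset.image_insert]

lemma LP.hasPath {n : ℕ} {x y : V} {S : Finset V} (h : LP col c n x y S) :
    HasLoosePath 4 n col c := by
  obtain ⟨f, h0, h1, h2, h3, h4⟩ := h.exists_fun
  refine ⟨f, ?_, ?_⟩
  · intro i hi j hj hij
    simp at hi hj
    exact h3 i j (by omega) (by omega) hij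
  · intro i hi
    rw [img4]
    have := h4 i hi
    simpa [mul_comm] using this

lemma LP.hasCycle {n : ℕ} {x y a b : V} {S : Finset V} (h : LP col c n x y S)
    (he : col {y, a, b, x} = c) (ha : a ∉ S) (hb : b ∉ S) (hab : a ≠ b) :
    HasLooseCycle 4 (n + 1) col c := by
  obtain ⟨f, h0, h1, h2, h3, h4⟩ := h.exists_fun
  let g : ℕ → V := fun i => if i ≤ 3 * n then f i else if i = 3 * n + 1 then a else b
  have g1 : ∀ i ≤ 3 * n, g i = f i := fun i hi => by simp [g, hi]
  have g2 : g (3 * n + 1) = a := by simp [g]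
  have g3 : g (3 * n + 2) = b := by simp [g]
  refine ⟨g, ?_, ?_⟩
  · intro i hi j hj hij
    simp at hi hj
    rcases (by omega : i ≤ 3 * n ∨ i = 3 * n + 1 ∨ i = 3 * n + 2) with hi' | rfl | rfl <;>
    rcases (by omega : j ≤ 3 * n ∨ j = 3 * n + 1 ∨ j = 3 * n + 2) with hj' | rfl | rfl
    · rw [g1 _ hi', g1 _ hj'] at hij; exact h3 i j hi' hj' hij
    · rw [g1 _ hi', g2] at hij; exact absurd (hij ▸ h2 i hi') ha
    · rw [g1 _ hi', g3] at hij; exact absurd (hij ▸ h2 i hi') hb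
    · rw [g1 _ hj', g2] at hij; exact absurd (hij.symm ▸ h2 j hj') ha
    · rfl
    · rw [g2, g3] at hij; exact absurd hij hab
    · rw [g1 _ hj', g3] at hij; exact absurd (hij.symm ▸ h2 j hj') hb
    · rw [g2, g3] at hij; exact absurd hij.symm hab
    · rfl
  · intro i hi
    rw [img4]
    rcases (by omega : i < n ∨ i = n) with hi' | rfl
    · have := h4 i hi'
      have m : ∀ j, j ≤ 3 → (i * (4 - 1) + j) % ((n + 1) * (4 - 1)) = 3 * i + j := by
        intro j hj
        rw [Nat.mod_eq_of_lt (by omega)]; omega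
      rw [m 0 (by omega), m 1 (by omega), m 2 (by omega), m 3 (by omega), g1 _ (by omega),
        g1 _ (by omega), g1 _ (by omega), g1 _ (by omega)]
      exact this
    · have m : ∀ j, j ≤ 2 → (i * (4 - 1) + j) % ((i + 1) * (4 - 1)) = 3 * i + j := by
        intro j hj
        rw [Nat.mod_eq_of_lt (by omega)]; omega
      have m3 : (i * (4 - 1) + 3) % ((i + 1) * (4 - 1)) = 0 := by
        have : i * (4 - 1) + 3 = (i + 1) * (4 - 1) := by omega
        rw [this, Nat.mod_self]
      rw [m 0 (by omega), m 1 (by omega), m 2 (by omega), m3, g2, g3, g1 _ (by omega),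
        g1 _ (by omega), h0, Nat.add_zero, h1]
      exact he

/-- the function `v` lists a loose path of color `c` with `L` edges -/
structure Sq (col : Finset V → Bool) (c : Bool) (L : ℕ) (v : ℕ → V) : Prop where
  inj : ∀ i j, i ≤ 3 * L → j ≤ 3 * L → v i = v j → i = j
  edge : ∀ i < L, col {v (3 * i), v (3 * i + 1), v (3 * i + 2), v (3 * i + 3)} = c

variable {L : ℕ} {v : ℕ → V}

lemma sq_of_path {n : ℕ} (h : HasLoosePath 4 n col c) : ∃ v, Sq col c n v := by
  obtain ⟨f, h1, h2⟩ := h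
  refine ⟨f, ?_, ?_⟩
  · intro i j hi hj hij
    exact h1 (by simp; omega) (by simp; omega) hij
  · intro i hi
    have := h2 i hi
    rw [img4] at this
    simpa [mul_comm] using this

lemma Sq.mem_iff (hv : Sq col c L v) {a b p : ℕ} (hb : b ≤ 3 * L) (hp : p ≤ 3 * L) :
    v p ∈ (Finset.Icc a b).image v ↔ a ≤ p ∧ p ≤ b := by
  constructor
  · intro h
    obtain ⟨j, hj, e⟩ := Finset.mem_image.1 h
    rw [Finset.mem_Icc] at hj
    have := hv.inj j p (by omega) hp e
    omega
  · intro h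
    exact Finset.mem_image_of_mem _ (Finset.mem_Icc.2 h)

lemma Sq.ne (hv : Sq col c L v) {p q : ℕ} (hp : p ≤ 3 * L) (hq : q ≤ 3 * L) (h : p ≠ q) :
    v p ≠ v q := fun e => h (hv.inj p q hp hq e)

lemma Sq.seg (hv : Sq col c L v) (i j : ℕ) (hij : i + j ≤ L) :
    LP col c j (v (3 * i)) (v (3 * (i + j))) ((Finset.Icc (3 * i) (3 * (i + j))).image v) := by
  induction j generalizing i with
  | zero => simpa using LP.nil (col := col) (c := c) (v (3 * i))
  | succ j ih =>
    have h := ih (i + 1) (by omega)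
    have e : i + 1 + j = i + (j + 1) := by ring
    rw [e] at h
    have e2 : Finset.Icc (3 * i) (3 * (i + (j + 1))) =
      insert (3 * i) (insert (3 * i + 1) (insert (3 * i + 2)
        (Finset.Icc (3 * (i + 1)) (3 * (i + (j + 1)))))) := by
      ext t; simp; omega
    rw [e2, Finset.image_insert, Finset.image_insert, Finset.image_insert]
    have he := hv.edge i (by omega)
    rw [show 3 * i + 3 = 3 * (i + 1) by ring] at he
    refine LP.cons he h ?_ ?_ ?_ (hv.ne ?_ ?_ ?_) (hv.ne ?_ ?_ ?_) (hv.ne ?_ ?_ ?_)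
    · rw [hv.mem_iff] <;> omega
    · rw [hv.mem_iff] <;> omega
    · rw [hv.mem_iff] <;> omega
    all_goals omega

/-- admissible end points of the initial segment with `i` edges -/
def St (i : ℕ) (p : ℕ) : Prop := p = 3 * i ∨ (1 ≤ i ∧ (p = 3 * i - 2 ∨ p = 3 * i - 1))

lemma Sq.pre (hv : Sq col c L v) {i p : ℕ} (hi : i ≤ L) (hp : St i p) :
    LP col c i (v 0) (v p) ((Finset.Icc 0 (3 * i)).image v) := by
  rcases hp with rfl | ⟨h1, hp⟩
  · have := hv.seg 0 i (by omega)
    simpa using this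
  · obtain ⟨i, rfl⟩ : ∃ k, i = k + 1 := ⟨i - 1, by omega⟩
    have h := hv.seg 0 i (by omega)
    simp only [Nat.mul_zero, Nat.zero_add] at h
    have he := hv.edge i (by omega)
    have e2 : (Finset.Icc 0 (3 * (i + 1))) = Finset.Icc 0 (3 * i) ∪
      {3 * i, 3 * i + 1, 3 * i + 2, 3 * i + 3} := by
      ext t; simp; omega
    rw [e2, Finset.image_union]
    rcases hp with rfl | rfl
    · have e3 : ({3 * i, 3 * i + 1, 3 * i + 2, 3 * i + 3} : Finset ℕ) =
        {3 * i, 3 * i + 2, 3 * i + 3, 3 * i + 1} := by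
        ext t; simp; omega
      have e4 : ({v (3 * i), v (3 * i + 1), v (3 * i + 2), v (3 * i + 3)} : Finset V) =
        {v (3 * i), v (3 * i + 2), v (3 * i + 3), v (3 * i + 1)} := by
        ext t; simp; tauto
      rw [e4] at he
      rw [e3, show 3 * (i + 1) - 2 = 3 * i + 1 by omega]
      simp only [Finset.image_insert, Finset.image_singleton]
      refine h.snoc he ?_ ?_ ?_ (hv.ne ?_ ?_ ?_) (hv.ne ?_ ?_ ?_) (hv.ne ?_ ?_ ?_)
      · rw [hv.mem_iff] <;> omega
      · rw [hv.mem_iff] <;> omega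
      · rw [hv.mem_iff] <;> omega
      all_goals omega
    · have e3 : ({3 * i, 3 * i + 1, 3 * i + 2, 3 * i + 3} : Finset ℕ) =
        {3 * i, 3 * i + 1, 3 * i + 3, 3 * i + 2} := by
        ext t; simp; omega
      have e4 : ({v (3 * i), v (3 * i + 1), v (3 * i + 2), v (3 * i + 3)} : Finset V) =
        {v (3 * i), v (3 * i + 1), v (3 * i + 3), v (3 * i + 2)} := by
        ext t; simp; tauto
      rw [e4] at he
      rw [e3, show 3 * (i + 1) - 1 = 3 * i + 2 by omega]
      simp only [Finset.image_insert, Finset.image_singleton]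
      refine h.snoc he ?_ ?_ ?_ (hv.ne ?_ ?_ ?_) (hv.ne ?_ ?_ ?_) (hv.ne ?_ ?_ ?_)
      · rw [hv.mem_iff] <;> omega
      · rw [hv.mem_iff] <;> omega
      · rw [hv.mem_iff] <;> omega
      all_goals omega

structure Ctx (col : Finset V → Bool) (c : Bool) (L : ℕ) (v : ℕ → V) (W : Finset V) : Prop where
  sq : Sq col c L v
  dis : ∀ i ≤ 3 * L, v i ∉ W
  ng : ∀ S, LP col c (L + 1) (v 0) (v (3 * L)) S → S ⊆ (Finset.Icc 0 (3 * L)).image v ∪ W → False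

variable {W : Finset V}

lemma St.le {i p : ℕ} (h : St i p) : p ≤ 3 * i := by
  rcases h with rfl | ⟨_, rfl | rfl⟩ <;> omega

lemma Ctx.glue (h : Ctx col c L v W) {i j p : ℕ} {S : Finset V} (hij : i + j ≤ L) (hj : 1 ≤ j)
    (hp : St i p) (hS : LP col c (j + 1) (v p) (v (3 * (i + j))) S)
    (hsub : ∀ y ∈ S, y = v p ∨ (∃ q, 3 * i + 1 ≤ q ∧ q ≤ 3 * (i + j) ∧ y = v q) ∨ y ∈ W) :
    False := by
  have hple := hp.le
  have h1 := h.sq.pre (by omega) hp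
  have h2 := h1.append hS (by
    intro y hy hy'
    rcases hsub y hy' with e | ⟨q, hq1, hq2, rfl⟩ | hw
    · exact e
    · rw [h.sq.mem_iff (by omega) (by omega)] at hy
      omega
    · obtain ⟨t, ht, rfl⟩ := Finset.mem_image.1 hy
      rw [Finset.mem_Icc] at ht
      exact absurd hw (h.dis t (by omega)))
  have h3 := h.sq.seg (i + j) (L - (i + j)) (by omega)
  rw [show i + j + (L - (i + j)) = L by omega] at h3
  have h4 := h2.append h3 (by
    intro y hy hy'
    rcases Finset.mem_union.1 hy with hy | hy
    · obtain ⟨t, ht, rfl⟩ := Finset.mem_image.1 hy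
      rw [Finset.mem_Icc] at ht
      rw [h.sq.mem_iff (by omega) (by omega)] at hy'
      omega
    · rcases hsub y hy with rfl | ⟨q, hq1, hq2, rfl⟩ | hw
      · rw [h.sq.mem_iff (by omega) (by omega)] at hy'
        omega
      · rw [h.sq.mem_iff (by omega) (by omega)] at hy'
        rw [show q = 3 * (i + j) by omega]
      · obtain ⟨t, ht, rfl⟩ := Finset.mem_image.1 hy'
        rw [Finset.mem_Icc] at ht
        exact absurd hw (h.dis t (by omega)))
  rw [show i + (j + 1) + (L - (i + j)) = L + 1 by omega] at h4
  refine h.ng _ h4 ?_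
  intro y hy
  rw [Finset.mem_union]
  have key : ∀ t ≤ 3 * L, v t ∈ (Finset.Icc 0 (3 * L)).image v := fun t ht =>
    Finset.mem_image_of_mem _ (Finset.mem_Icc.2 ⟨by omega, ht⟩)
  rcases Finset.mem_union.1 hy with hy | hy
  · rcases Finset.mem_union.1 hy with hy | hy
    · obtain ⟨t, ht, rfl⟩ := Finset.mem_image.1 hy
      rw [Finset.mem_Icc] at ht
      exact Or.inl (key _ (by omega))
    · rcases hsub y hy with rfl | ⟨q, hq1, hq2, rfl⟩ | hw
      · exact Or.inl (key _ (by omega))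
      · exact Or.inl (key _ (by omega))
      · exact Or.inr hw
  · obtain ⟨t, ht, rfl⟩ := Finset.mem_image.1 hy
    rw [Finset.mem_Icc] at ht
    exact Or.inl (key _ (by omega))

/-- five distinct inner indices of a block -/
def Fv (x₁ x₂ x₃ x₄ x₅ : ℕ) : Prop :=
  [x₁, x₂, x₃, x₄, x₅].Nodup ∧ ∀ x ∈ [x₁, x₂, x₃, x₄, x₅], 1 ≤ x ∧ x ≤ 5

instance (x₁ x₂ x₃ x₄ x₅ : ℕ) : Decidable (Fv x₁ x₂ x₃ x₄ x₅) := by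
  unfold Fv; infer_instance

lemma block_prop (A G : ℕ → ℕ → Prop) (M : ℕ → ℕ → ℕ → Prop)
    (hA : ∀ i j, A i j → A j i) (hG : ∀ i j, G i j → G j i)
    (M1 : ∀ x₁ x₂ x₃ x₄ x₅, Fv x₁ x₂ x₃ x₄ x₅ → A x₁ x₂ → M x₂ x₃ x₄ → G x₄ x₅ → False) :
    (∃ x y v z u, Fv x y v z u ∧ ¬ M x v z ∧ ¬ M y v u) ∨
    (∃ p q s t r, Fv p q s t r ∧ ¬ A p q ∧ ¬ A s t) ∨
    (∃ p q s t, Fv p q s t 4 ∧ ¬ G p q ∧ ¬ G s t) := by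
  by_contra hcon
  push Not at hcon
  obtain ⟨n1, n2, n3⟩ := hcon
  have cross : ∀ x y v z u, Fv x y v z u → A x y → G z u → False := by
    intro x y v z u h ha hg
    have p1 : Fv y x v z u := by
      unfold Fv at *; simp at *; omega
    have p2 : Fv x y v u z := by
      unfold Fv at *; simp at *; omega
    have h1 : ¬ M x v z := fun hm => M1 _ _ _ _ _ p1 (hA _ _ ha) hm hg
    exact M1 _ _ _ _ _ p2 ha (n1 _ _ _ _ _ h h1) (hG _ _ hg)
  have nA : ∀ x y v z u, Fv x y v z u → G z u → ¬ A x y := fun x y v z u h hg ha =>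
    cross x y v z u h ha hg
  by_cases g1 : G 1 2
  · have a1 := nA 3 5 4 1 2 (by decide) g1
    have a2 := nA 4 5 3 1 2 (by decide) g1
    by_cases g2 : G 1 3
    · exact a1 (n2 2 4 3 5 1 (by decide) (nA 2 4 5 1 3 (by decide) g2))
    · have g3 := n3 1 3 2 5 (by decide) g2
      exact a2 (n2 1 3 4 5 2 (by decide) (nA 1 3 4 2 5 (by decide) g3))
  · have g1' := n3 1 2 3 5 (by decide) g1
    have a1 := nA 1 4 2 3 5 (by decide) g1'
    have a2 := nA 2 4 1 3 5 (by decide) g1'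
    by_cases g2 : G 1 3
    · exact a1 (n2 2 5 1 4 3 (by decide) (nA 2 5 4 1 3 (by decide) g2))
    · have g3 := n3 1 3 2 5 (by decide) g2
      exact a2 (n2 1 3 2 4 5 (by decide) (nA 1 3 4 2 5 (by decide) g3))

/-- the vertices of `W` joined to `T` in color `c` -/
def Rs (col : Finset V → Bool) (c : Bool) (W T : Finset V) : Finset V :=
  W.filter fun w => col (insert w T) = c

lemma sdr3 (A B C : Finset V) (hA : 3 ≤ A.card) (hB : 3 ≤ B.card) (hC : 3 ≤ C.card) :
    ∃ a ∈ A, ∃ b ∈ B, ∃ d ∈ C, a ≠ b ∧ a ≠ d ∧ b ≠ d := by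
  obtain ⟨a, ha⟩ := Finset.card_pos.1 (by omega : 0 < A.card)
  obtain ⟨b, hb, hba⟩ := Finset.exists_mem_notMem_of_card_lt_card
    (s := {a}) (t := B) (by simp; omega)
  obtain ⟨d, hd, hda⟩ := Finset.exists_mem_notMem_of_card_lt_card
    (s := {a, b}) (t := C) (lt_of_le_of_lt Finset.card_le_two (by omega))
  simp at hba hda
  exact ⟨a, ha, b, hb, d, hd, by tauto, by tauto, by tauto⟩

lemma Ctx.gain3 (h : Ctx col c L v W) {i p : ℕ} (hi : i + 2 ≤ L) (hp : St i p)
    {x₁ x₂ x₃ x₄ x₅ : ℕ} (hx : Fv x₁ x₂ x₃ x₄ x₅)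
    (h1 : 3 ≤ (Rs col c W {v p, v (3 * i + x₁), v (3 * i + x₂)}).card)
    (h2 : 3 ≤ (Rs col c W {v (3 * i + x₂), v (3 * i + x₃), v (3 * i + x₄)}).card)
    (h3 : 3 ≤ (Rs col c W {v (3 * i + x₄), v (3 * i + x₅), v (3 * i + 6)}).card) : False := by
  obtain ⟨w₁, hw₁, w₂, hw₂, w₃, hw₃, n12, n13, n23⟩ := sdr3 _ _ _ h1 h2 h3
  simp only [Rs, Finset.mem_filter] at hw₁ hw₂ hw₃
  obtain ⟨hw₁, e1⟩ := hw₁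
  obtain ⟨hw₂, e2⟩ := hw₂
  obtain ⟨hw₃, e3⟩ := hw₃
  have hple := hp.le
  have hd := h.dis
  obtain ⟨hx1, hx2⟩ := hx
  simp at hx1 hx2
  have vw : ∀ t ≤ 3 * L, ∀ w ∈ W, v t ≠ w := fun t ht w hw e => hd t ht (e ▸ hw)
  have f1 : col {v p, v (3 * i + x₁), w₁, v (3 * i + x₂)} = c := by
    rw [← e1]; congr 1; ext t; simp; tauto
  have f2 : col {v (3 * i + x₂), v (3 * i + x₃), w₂, v (3 * i + x₄)} = c := by
    rw [← e2]; congr 1; ext t; simp; tauto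
  have f3 : col {v (3 * i + x₄), v (3 * i + x₅), w₃, v (3 * i + 6)} = c := by
    rw [← e3]; congr 1; ext t; simp; tauto
  have b1 : v p ≠ v (3 * i + x₁) := h.sq.ne (by omega) (by omega) (by omega)
  have b2 : v p ≠ v (3 * i + x₂) := h.sq.ne (by omega) (by omega) (by omega)
  have b3 : v p ≠ v (3 * i + x₃) := h.sq.ne (by omega) (by omega) (by omega)
  have b4 : v p ≠ v (3 * i + x₄) := h.sq.ne (by omega) (by omega) (by omega)
  have b5 : v p ≠ v (3 * i + x₅) := h.sq.ne (by omega) (by omega) (by omega)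
  have b6 : v p ≠ v (3 * i + 6) := h.sq.ne (by omega) (by omega) (by omega)
  have c12 : v (3 * i + x₁) ≠ v (3 * i + x₂) := h.sq.ne (by omega) (by omega) (by omega)
  have c13 : v (3 * i + x₁) ≠ v (3 * i + x₃) := h.sq.ne (by omega) (by omega) (by omega)
  have c14 : v (3 * i + x₁) ≠ v (3 * i + x₄) := h.sq.ne (by omega) (by omega) (by omega)
  have c15 : v (3 * i + x₁) ≠ v (3 * i + x₅) := h.sq.ne (by omega) (by omega) (by omega)
  have c16 : v (3 * i + x₁) ≠ v (3 * i + 6) := h.sq.ne (by omega) (by omega) (by omega)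
  have c23 : v (3 * i + x₂) ≠ v (3 * i + x₃) := h.sq.ne (by omega) (by omega) (by omega)
  have c24 : v (3 * i + x₂) ≠ v (3 * i + x₄) := h.sq.ne (by omega) (by omega) (by omega)
  have c25 : v (3 * i + x₂) ≠ v (3 * i + x₅) := h.sq.ne (by omega) (by omega) (by omega)
  have c26 : v (3 * i + x₂) ≠ v (3 * i + 6) := h.sq.ne (by omega) (by omega) (by omega)
  have c34 : v (3 * i + x₃) ≠ v (3 * i + x₄) := h.sq.ne (by omega) (by omega) (by omega)
  have c35 : v (3 * i + x₃) ≠ v (3 * i + x₅) := h.sq.ne (by omega) (by omega) (by omega)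
  have c36 : v (3 * i + x₃) ≠ v (3 * i + 6) := h.sq.ne (by omega) (by omega) (by omega)
  have c45 : v (3 * i + x₄) ≠ v (3 * i + x₅) := h.sq.ne (by omega) (by omega) (by omega)
  have c46 : v (3 * i + x₄) ≠ v (3 * i + 6) := h.sq.ne (by omega) (by omega) (by omega)
  have c56 : v (3 * i + x₅) ≠ v (3 * i + 6) := h.sq.ne (by omega) (by omega) (by omega)
  have d0 := vw p (by omega)
  have d1 := vw (3 * i + x₁) (by omega)
  have d2 := vw (3 * i + x₂) (by omega)
  have d3 := vw (3 * i + x₃) (by omega)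
  have d4 := vw (3 * i + x₄) (by omega)
  have d5 := vw (3 * i + x₅) (by omega)
  have d6 := vw (3 * i + 6) (by omega)
  have l3 := LP.single f3 (by simp; grind)
  have l2 := LP.cons f2 l3 (by simp; grind) (by simp; grind) (by simp; grind) (by grind) (by grind)
    (by grind)
  have l1 := LP.cons f1 l2 (by simp; grind) (by simp; grind) (by simp; grind) (by grind) (by grind)
    (by grind)
  refine h.glue (i := i) (j := 2) (p := p) hi (by omega) hp
    (by rw [show 3 * (i + 2) = 3 * i + 6 by ring]; exact l1) ?_
  intro y hy
  have kk : ∀ t, 1 ≤ t → t ≤ 6 →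
    ∃ q, 3 * i + 1 ≤ q ∧ q ≤ 3 * (i + 2) ∧ v (3 * i + t) = v q := fun t h1 h2 =>
      ⟨3 * i + t, by omega, by omega, rfl⟩
  simp only [Finset.mem_insert, Finset.mem_singleton] at hy
  rcases hy with rfl | rfl | rfl | rfl | rfl | rfl | rfl | rfl | rfl | rfl
  · exact Or.inl rfl
  · exact Or.inr (Or.inl (kk _ (by omega) (by omega)))
  · exact Or.inr (Or.inr hw₁)
  · exact Or.inr (Or.inl (kk _ (by omega) (by omega)))
  · exact Or.inr (Or.inl (kk _ (by omega) (by omega)))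
  · exact Or.inr (Or.inr hw₂)
  · exact Or.inr (Or.inl (kk _ (by omega) (by omega)))
  · exact Or.inr (Or.inl (kk _ (by omega) (by omega)))
  · exact Or.inr (Or.inr hw₃)
  · exact Or.inr (Or.inl (kk _ (by omega) (by omega)))

/-- the block lemma, in terms of indices -/
lemma Ctx.block (h : Ctx col c L v W) {i p : ℕ} (hi : i + 2 ≤ L) (hp : St i p) :
    ∃ p₁ p₂ q s₁ s₂ y : ℕ, [p₁, p₂, q, s₁, s₂].Nodup ∧ y ∉ [p₁, p₂, q, s₁, s₂] ∧ St (i + 2) y ∧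
      (∀ t ∈ [p₁, p₂, q, s₁, s₂], t = p ∨ (3 * i + 1 ≤ t ∧ t ≤ 3 * i + 6)) ∧
      (Rs col c W {v p₁, v p₂, v q}).card ≤ 2 ∧ (Rs col c W {v q, v s₁, v s₂}).card ≤ 2 := by
  have hple := hp.le
  have key := block_prop
    (fun a b => 3 ≤ (Rs col c W {v p, v (3 * i + a), v (3 * i + b)}).card)
    (fun a b => 3 ≤ (Rs col c W {v (3 * i + a), v (3 * i + b), v (3 * i + 6)}).card)
    (fun a b d => 3 ≤ (Rs col c W {v (3 * i + a), v (3 * i + b), v (3 * i + d)}).card)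
    (by
      intro a b hab
      rw [Finset.pair_comm]; exact hab)
    (by
      intro a b hab
      rw [Finset.insert_comm]; exact hab)
    (fun x₁ x₂ x₃ x₄ x₅ hx h1 h2 h3 => h.gain3 hi hp hx h1 h2 h3)
  rcases key with ⟨x, y, m, z, u, hF, h1, h2⟩ | ⟨a, b, s, t, r, hF, h1, h2⟩ |
    ⟨a, b, s, t, hF, h1, h2⟩
  · obtain ⟨hF1, hF2⟩ := hF
    simp at hF1 hF2
    refine ⟨3 * i + x, 3 * i + z, 3 * i + m, 3 * i + y, 3 * i + u, 3 * i + 6, by simp; omega,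
      by simp; omega, Or.inl (by ring), by simp; omega, ?_, ?_⟩
    · rw [Finset.pair_comm]; omega
    · rw [Finset.insert_comm]; omega
  · obtain ⟨hF1, hF2⟩ := hF
    simp at hF1 hF2
    refine ⟨3 * i + a, 3 * i + b, p, 3 * i + s, 3 * i + t, 3 * i + 6, by simp; omega,
      by simp; omega, Or.inl (by ring), by simp; omega, ?_, ?_⟩
    · rw [Finset.pair_comm, Finset.insert_comm]; omega
    · omega
  · obtain ⟨hF1, hF2⟩ := hF
    simp at hF1 hF2
    refine ⟨3 * i + a, 3 * i + b, 3 * i + 6, 3 * i + s, 3 * i + t, 3 * i + 4, by simp; omega,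
      by simp; omega, Or.inr ⟨by omega, Or.inl (by omega)⟩, by simp; omega, ?_, ?_⟩
    · omega
    · rw [Finset.insert_comm, Finset.pair_comm]; omega

lemma Rs_notMem {T : Finset V} {w : V} (hw : w ∈ W) (h : w ∉ Rs col c W T) :
    col (insert w T) = !c := by
  simp only [Rs, Finset.mem_filter, not_and] at h
  have := h hw
  revert this
  cases col (insert w T) <;> cases c <;> simp

lemma exists_avoid (A E : Finset V) (h : E.card < A.card) : ∃ a ∈ A, a ∉ E :=
  Finset.exists_mem_notMem_of_card_lt_card h

lemma Ctx.blk (h : Ctx col c L v W) {p₁ p₂ q s₁ s₂ : ℕ} (hn : [p₁, p₂, q, s₁, s₂].Nodup)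
    (hle : ∀ t ∈ [p₁, p₂, q, s₁, s₂], t ≤ 3 * L) {w w' : V} (hw : w ∈ W) (hw' : w' ∈ W)
    (hne : w ≠ w') (h1 : w ∉ Rs col c W {v p₁, v p₂, v q})
    (h2 : w' ∉ Rs col c W {v q, v s₁, v s₂}) :
    LP col (!c) 2 w w' {w, v p₁, v p₂, v q, v s₁, v s₂, w'} := by
  have e1 := Rs_notMem hw h1
  have e2 := Rs_notMem hw' h2
  have f2 : col {v q, v s₁, v s₂, w'} = !c := by
    rw [← e2]; congr 1; ext t; simp; tauto
  simp at hn hle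
  have vw : ∀ t ≤ 3 * L, ∀ w ∈ W, v t ≠ w := fun t ht w hw e => h.dis t ht (e ▸ hw)
  have c12 : v p₁ ≠ v p₂ := h.sq.ne (by omega) (by omega) (by omega)
  have c13 : v p₁ ≠ v q := h.sq.ne (by omega) (by omega) (by omega)
  have c14 : v p₁ ≠ v s₁ := h.sq.ne (by omega) (by omega) (by omega)
  have c15 : v p₁ ≠ v s₂ := h.sq.ne (by omega) (by omega) (by omega)
  have c23 : v p₂ ≠ v q := h.sq.ne (by omega) (by omega) (by omega)
  have c24 : v p₂ ≠ v s₁ := h.sq.ne (by omega) (by omega) (by omega)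
  have c25 : v p₂ ≠ v s₂ := h.sq.ne (by omega) (by omega) (by omega)
  have c34 : v q ≠ v s₁ := h.sq.ne (by omega) (by omega) (by omega)
  have c35 : v q ≠ v s₂ := h.sq.ne (by omega) (by omega) (by omega)
  have c45 : v s₁ ≠ v s₂ := h.sq.ne (by omega) (by omega) (by omega)
  have d1 := vw p₁ (by omega)
  have d2 := vw p₂ (by omega)
  have d3 := vw q (by omega)
  have d4 := vw s₁ (by omega)
  have d5 := vw s₂ (by omega)
  have l2 := LP.single f2 (by simp; grind)
  exact LP.cons e1 l2 (by simp; grind) (by simp; grind) (by simp; grind) (by grind) (by grind)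
    (by grind)

set_option maxHeartbeats 1000000 in
lemma Ctx.chain_aux (h : Ctx col c L v W) (t : ℕ) (ht : 2 * (t + 1) ≤ L)
    (hW : t + 4 ≤ W.card) :
    ∃ (y : ℕ) (Q A E₀ E₁ : Finset V), St (2 * (t + 1)) y ∧
      (∀ z ∈ Q, ∃ q ≤ 6 * (t + 1), z = v q ∧ q ≠ y) ∧ A ⊆ W ∧ A.card = t ∧
      E₀.card ≤ 2 ∧ E₁.card ≤ 2 ∧
      ∀ w ∈ W, ∀ w' ∈ W, w ∉ A → w' ∉ A → w ≠ w' → w ∉ E₀ → w' ∉ E₁ →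
        LP col (!c) (2 * (t + 1)) w w' (Q ∪ A ∪ {w, w'}) := by
  induction t with
  | zero =>
    obtain ⟨p₁, p₂, q, s₁, s₂, y, hn, hny, hy, hin, r1, r2⟩ :=
      h.block (i := 0) (p := 0) (by omega) (Or.inl rfl)
    refine ⟨y, {v p₁, v p₂, v q, v s₁, v s₂}, ∅, _, _, by simpa using hy, ?_, by simp, by simp,
      r1, r2, ?_⟩
    · intro z hz
      obtain ⟨a, ha, rfl⟩ : ∃ a ∈ [p₁, p₂, q, s₁, s₂], z = v a := by simpa using hz
      have := hin a ha
      exact ⟨a, by omega, rfl, fun e => hny (e ▸ ha)⟩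
    · intro w hw w' hw' _ _ hne h1 h2
      have := h.blk hn (fun a ha => by have := hin a ha; omega) hw hw' hne h1 h2
      convert this using 1
      ext z; simp <;> tauto
  | succ t ih =>
    obtain ⟨y, Q, A, E₀, E₁, hy, hQ, hA, hAc, hE₀, hE₁, hP⟩ := ih (by omega) (by omega)
    have hyle := hy.le
    obtain ⟨p₁, p₂, q, s₁, s₂, y', hn2, hny, hy', hin, r1, r2⟩ :=
      h.block (i := 2 * (t + 1)) (p := y) (by omega) hy
    have hin2 : ∀ t ∈ [p₁, p₂, q, s₁, s₂], t ≤ 3 * L := fun a ha => by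
      have := hin a ha; omega
    have hy'' : 6 * (t + 1) + 1 ≤ y' := by
      rcases hy' with h | ⟨_, h | h⟩ <;> omega
    obtain ⟨m, hm, hmE⟩ := exists_avoid (W \ A) (E₁ ∪ Rs col c W {v p₁, v p₂, v q}) (by
      have h1 := Finset.card_union_le E₁ (Rs col c W {v p₁, v p₂, v q})
      have h2 := Finset.card_sdiff_add_card_eq_card hA
      omega)
    simp only [Finset.mem_sdiff, Finset.mem_union, not_or] at hm hmE
    refine ⟨y', Q ∪ {v p₁, v p₂, v q, v s₁, v s₂}, insert m A, E₀, _, hy', ?_, ?_, ?_, hE₀, r2, ?_⟩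
    · intro z hz
      rcases Finset.mem_union.1 hz with hz | hz
      · obtain ⟨a, ha, rfl, _⟩ := hQ z hz
        exact ⟨a, by omega, rfl, by omega⟩
      obtain ⟨a, ha, rfl⟩ : ∃ a ∈ [p₁, p₂, q, s₁, s₂], z = v a := by simpa using hz
      have := hin a ha
      exact ⟨a, by omega, rfl, fun e => hny (e ▸ ha)⟩
    · exact Finset.insert_subset hm.1 hA
    · rw [Finset.card_insert_of_notMem hm.2, hAc]
    · intro w hw w' hw' hwA hw'A hne h1 h2
      simp only [Finset.mem_insert, not_or] at hwA hw'A
      have l1 := hP w hw m hm.1 hwA.2 hm.2 hwA.1 h1 hmE.1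
      have l2 := h.blk hn2 hin2 hm.1 hw' (Ne.symm hw'A.1) hmE.2 h2
      have l3 := l1.append l2 (by
        have vw : ∀ t ≤ 3 * L, v t ∉ W := h.dis
        have hdis : ∀ a ∈ [p₁, p₂, q, s₁, s₂],
            v a ∉ Q ∧ v a ∉ W := by
          intro a ha
          have ha2 : a ≤ 3 * L := hin2 a ha
          have ha3 := hin a ha
          refine ⟨fun hq => ?_, h.dis a ha2⟩
          obtain ⟨b, hb, e, hby⟩ := hQ _ hq
          have := h.sq.inj a b ha2 (by omega) e
          omega
        have hQW : ∀ z ∈ Q, z ∉ W := by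
          intro z hz
          obtain ⟨b, hb, rfl, hby⟩ := hQ _ hz
          exact h.dis b (by omega)
        intro z hz hz'
        have hzQ : z ∈ Q ∨ z ∈ A ∨ z = w ∨ z = m := by
          simp only [Finset.mem_union, Finset.mem_insert, Finset.mem_singleton] at hz
          rcases hz with (h | h) | h | h <;> simp [h]
        have hz2 : z ∈ Q ∨ z ∈ W := by
          rcases hzQ with h | h | rfl | rfl
          · exact Or.inl h
          · exact Or.inr (hA h)
          · exact Or.inr hw
          · exact Or.inr hm.1
        simp only [Finset.mem_insert, Finset.mem_singleton] at hz'
        rcases hz' with rfl | rfl | rfl | rfl | rfl | rfl | rfl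
        · rfl
        · have := hdis p₁ (by simp); exact (hz2.elim this.1 this.2).elim
        · have := hdis p₂ (by simp); exact (hz2.elim this.1 this.2).elim
        · have := hdis q (by simp); exact (hz2.elim this.1 this.2).elim
        · have := hdis s₁ (by simp); exact (hz2.elim this.1 this.2).elim
        · have := hdis s₂ (by simp); exact (hz2.elim this.1 this.2).elim
        · exfalso
          rcases hzQ with h | h | h | h
          · exact hQW _ h hw'
          · exact hw'A.2 h
          · exact hne h.symm
          · exact hw'A.1 h)
      rw [show 2 * (t + 1 + 1) = 2 * (t + 1) + 2 by ring]
      convert l3 using 1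
      ext z
      simp only [Finset.mem_union, Finset.mem_insert, Finset.mem_singleton]
      clear * -
      tauto

/-- the main chain lemma -/
lemma Ctx.chain (h : Ctx col c L v W) (s : ℕ) (hs : 2 * s ≤ L) (hW : s + 3 ≤ W.card)
    (Y : Finset V) (hY : Y.card ≤ 1) :
    ∃ (y : ℕ) (Q A : Finset V) (w w' : V), St (2 * s) y ∧
      (∀ z ∈ Q, ∃ q ≤ 6 * s, z = v q ∧ q ≠ y) ∧ A ⊆ W ∧ A.card = s + 1 ∧
      w ∈ A ∧ w' ∈ A ∧ w' ∉ Y ∧ (1 ≤ s → w ≠ w') ∧ LP col (!c) (2 * s) w w' (Q ∪ A) := by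
  rcases Nat.eq_zero_or_pos s with rfl | hs1
  · obtain ⟨w, hw, hwY⟩ := exists_avoid W Y (by omega)
    refine ⟨0, ∅, {w}, w, w, Or.inl rfl, by simp, by simpa using hw, by simp, by simp, by simp,
      hwY, by omega, ?_⟩
    simpa using LP.nil (col := col) (c := !c) w
  · obtain ⟨t, rfl⟩ : ∃ t, s = t + 1 := ⟨s - 1, by omega⟩
    obtain ⟨y, Q, A, E₀, E₁, hy, hQ, hA, hAc, hE₀, hE₁, hP⟩ := h.chain_aux t hs (by omega)
    have h2 := Finset.card_sdiff_add_card_eq_card hA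
    obtain ⟨w', hw', hw'E⟩ := exists_avoid (W \ A) (E₁ ∪ Y) (by
      have h1 := Finset.card_union_le E₁ Y
      omega)
    obtain ⟨w, hw, hwE⟩ := exists_avoid (W \ A) (insert w' E₀) (by
      have h1 := Finset.card_insert_le w' E₀
      omega)
    simp only [Finset.mem_sdiff, Finset.mem_union, Finset.mem_insert, not_or] at hw' hw'E hw hwE
    refine ⟨y, Q, A ∪ {w, w'}, w, w', hy, hQ, ?_, ?_, by simp, by simp, hw'E.2,
      fun _ => hwE.1, ?_⟩
    · intro z hz
      simp at hz
      rcases hz with rfl | rfl | hz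
      · exact hw.1
      · exact hw'.1
      · exact hA hz
    · rw [Finset.card_union_of_disjoint, Finset.card_pair hwE.1, hAc]
      simp [hw.2, hw'.2]
    · have := hP w hw.1 w' hw'.1 hw.2 hw'.2 hwE.1 hwE.2 hw'E.1
      rwa [Finset.union_assoc] at this

lemma pick (S : Finset V) (n : ℕ) (h : n ≤ S.card) :
    ∃ l : List V, l.length = n ∧ l.Nodup ∧ ∀ x ∈ l, x ∈ S :=
  ⟨S.toList.take n, by simp [h], (S.nodup_toList).sublist (List.take_sublist _ _),
    fun x hx => Finset.mem_toList.1 (List.mem_of_mem_take hx)⟩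

lemma pick2 (S : Finset V) (h : 2 ≤ S.card) : ∃ a b : V, a ≠ b ∧ a ∈ S ∧ b ∈ S := by
  obtain ⟨l, h1, h2, h3⟩ := pick S 2 h
  match l, h1 with
  | [a, b], _ =>
    simp at h2 h3
    exact ⟨a, b, h2, h3.1, h3.2⟩

lemma pick4 (S : Finset V) (h : 4 ≤ S.card) : ∃ a b d e : V, [a, b, d, e].Nodup ∧
    a ∈ S ∧ b ∈ S ∧ d ∈ S ∧ e ∈ S := by
  obtain ⟨l, h1, h2, h3⟩ := pick S 4 h
  match l, h1 with
  | [a, b, d, e], _ =>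
    simp only [List.forall_mem_cons] at h3
    exact ⟨a, b, d, e, h2, by tauto⟩

lemma pick6 (S : Finset V) (h : 6 ≤ S.card) : ∃ a b d e f g : V, [a, b, d, e, f, g].Nodup ∧
    a ∈ S ∧ b ∈ S ∧ d ∈ S ∧ e ∈ S ∧ f ∈ S ∧ g ∈ S := by
  obtain ⟨l, h1, h2, h3⟩ := pick S 6 h
  match l, h1 with
  | [a, b, d, e, f, g], _ =>
    simp only [List.forall_mem_cons] at h3
    exact ⟨a, b, d, e, f, g, h2, by tauto⟩

/-- a path that cannot be extended -/
structure Mx (col : Finset V → Bool) (c : Bool) (L : ℕ) (v : ℕ → V) (W : Finset V) : Prop where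
  sq : Sq col c L v
  dis : ∀ i ≤ 3 * L, v i ∉ W
  np : ¬ HasLoosePath 4 (L + 1) col c

lemma Mx.ctx (h : Mx col c L v W) : Ctx col c L v W :=
  ⟨h.sq, h.dis, fun _ hS _ => h.np hS.hasPath⟩

lemma eq_not_of_ne {b d : Bool} (h : b ≠ d) : b = !d := by
  cases b <;> cases d <;> simp_all

lemma Mx.endE (h : Mx col c L v W) {p : ℕ} (hp : St L p) {a b d : V} (ha : a ∈ W) (hb : b ∈ W)
    (hd : d ∈ W) (hn : [a, b, d].Nodup) : col {v p, a, b, d} = !c := by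
  apply eq_not_of_ne
  intro he
  have hni : ∀ z ∈ W, z ∉ (Finset.Icc 0 (3 * L)).image v := by
    intro z hz hz'
    obtain ⟨t, ht, rfl⟩ := Finset.mem_image.1 hz'
    rw [Finset.mem_Icc] at ht
    exact h.dis t ht.2 hz
  simp at hn
  exact h.np ((h.sq.pre le_rfl hp).snoc he (hni _ ha) (hni _ hb) (hni _ hd) (by tauto) (by tauto)
    (by tauto)).hasPath

lemma Mx.start (h : Mx col c L v W) (s : ℕ) (hs : 2 * s ≤ L) (hW : s + 3 ≤ W.card)
    (Y : Finset V) (hY : Y.card ≤ 1) :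
    ∃ (e : ℕ) (Q A : Finset V) (w w' : V), St L e ∧ v e ∉ Q ∧
      (∀ q, 6 * s < q → q ≤ 3 * L → v q ∉ Q ∪ A) ∧ (∀ z ∈ W, z ∉ Q) ∧
      A ⊆ W ∧ A.card = s + 1 ∧
      w ∈ A ∧ w' ∈ A ∧ w' ∉ Y ∧ (1 ≤ s → w ≠ w') ∧ LP col (!c) (2 * s) w w' (Q ∪ A) := by
  obtain ⟨y, Q, A, w, w', hy, hQ, hA, hAc, hw, hw', hwY, hne, hP⟩ := h.ctx.chain s hs hW Y hY
  have hyle := hy.le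
  have h1 : ∀ q, 6 * s < q → q ≤ 3 * L → v q ∉ Q ∪ A := by
    intro q hq hq' hm
    rcases Finset.mem_union.1 hm with hm | hm
    · obtain ⟨t, ht, e, _⟩ := hQ _ hm
      have := h.sq.inj q t hq' (by omega) e
      omega
    · exact h.dis q hq' (hA hm)
  have h2 : ∀ z ∈ W, z ∉ Q := by
    intro z hz hzQ
    obtain ⟨t, ht, rfl, _⟩ := hQ _ hzQ
    exact h.dis t (by omega) hz
  rcases (by omega : L = 2 * s ∨ 2 * s < L) with e | hlt
  · refine ⟨y, Q, A, w, w', e ▸ hy, ?_, h1, h2, hA, hAc, hw, hw', hwY, hne, hP⟩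
    intro hm
    obtain ⟨t, ht, e', hty⟩ := hQ _ hm
    exact hty (h.sq.inj y t (by omega) (by omega) e').symm
  · refine ⟨3 * L, Q, A, w, w', Or.inl rfl, ?_, h1, h2, hA, hAc, hw, hw', hwY, hne, hP⟩
    intro hm
    exact h1 (3 * L) (by omega) le_rfl (Finset.mem_union_left _ hm)

lemma Mx.close_odd1 (h : Mx col c L v W) {r : ℕ} (hr : 1 ≤ r) (hrL : 2 * r ≤ L)
    (hW : r + 3 ≤ W.card) : HasLooseCycle 4 (2 * r + 1) col (!c) := by
  obtain ⟨e, Q, A, w, w', he, heQ, hbig, hWQ, hA, hAc, hw, hw', -, hne, hP⟩ :=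
    h.start r hrL hW ∅ (by simp)
  have hele := he.le
  obtain ⟨u, hu, huA⟩ := exists_avoid W A (by omega)
  have heA : v e ∉ W := h.dis e hele
  have hE := h.endE he (hA hw') hu (hA hw) (by
    have := hne hr
    simp; grind)
  refine hP.hasCycle (a := v e) (b := u) ?_ ?_ ?_ ?_
  · rw [← hE]; congr 1; ext z; simp; tauto
  · simp [heQ]; exact fun hh => heA (hA hh)
  · simp [huA, hWQ u hu]
  · rintro rfl; exact heA hu

set_option maxHeartbeats 2000000 in
lemma Mx.close_odd2 (h : Mx col c L v W) {s : ℕ} (hrL : L = 2 * s + 1)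
    (hW : s + 7 ≤ W.card) : HasLooseCycle 4 (2 * s + 3) col (!c) := by
  obtain ⟨-, Q, A, w, w', -, -, hbig, hWQ, hA, hAc, hw, hw', -, -, hP⟩ :=
    h.start s (by omega) (by omega) ∅ (by simp)
  have h2 := Finset.card_sdiff_add_card_eq_card hA
  obtain ⟨u₁, u₂, u₃, u₄, u₅, u₆, hn, m1, m2, m3, m4, m5, m6⟩ := pick6 (W \ A) (by omega)
  have hU : ∀ u ∈ W \ A, u ∈ W ∧ u ∉ Q ∧ u ∉ A ∧ u ≠ w ∧ u ≠ w' ∧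
      u ≠ v (3 * L) ∧ u ≠ v (3 * L - 1) := by
    intro u hu
    rw [Finset.mem_sdiff] at hu
    refine ⟨hu.1, hWQ u hu.1, hu.2, ?_, ?_, ?_, ?_⟩
    · rintro rfl; exact hu.2 hw
    · rintro rfl; exact hu.2 hw'
    · rintro rfl; exact h.dis _ le_rfl hu.1
    · rintro rfl; exact h.dis _ (by omega) hu.1
  have b1 := hU _ m1
  have b2 := hU _ m2
  have b3 := hU _ m3
  have b4 := hU _ m4
  have b5 := hU _ m5
  have b6 := hU _ m6
  have he := hbig (3 * L) (by omega) le_rfl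
  have hf := hbig (3 * L - 1) (by omega) (by omega)
  have hef : v (3 * L) ≠ v (3 * L - 1) := h.sq.ne le_rfl (by omega) (by omega)
  have hsE : St L (3 * L) := Or.inl rfl
  have hsF : St L (3 * L - 1) := Or.inr ⟨by omega, Or.inr rfl⟩
  have hwW := hA hw
  have hwW' := hA hw'
  have hwf : w' ≠ v (3 * L - 1) := by rintro hh; exact h.dis _ (by omega) (hh ▸ hwW')
  simp only [List.nodup_cons, List.mem_cons, List.not_mem_nil, or_false, not_or] at hn
  rw [Finset.mem_union, not_or] at he hf
  have E1 := h.endE hsE hwW' b1.1 b2.1 (by simp; grind)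
  have E2 := h.endE hsE b3.1 b4.1 b5.1 (by simp; grind)
  have E3 := h.endE hsF b5.1 b6.1 hwW (by simp; grind)
  have l1 := hP.snoc (a := u₁) (b := u₂) (z := v (3 * L))
    (by rw [← E1]; congr 1; ext z; simp; tauto) (by simp; tauto) (by simp; tauto) (by simp; tauto)
    (by tauto) (by tauto) (by tauto)
  have l2 := l1.snoc (a := u₃) (b := u₄) (z := u₅) E2
    (by simp; grind) (by simp; grind) (by simp; grind)
    (by tauto) (by tauto) (by tauto)
  exact l2.hasCycle (a := v (3 * L - 1)) (b := u₆)
    (by rw [← E3]; congr 1; ext z; simp; tauto) (by simp; grind) (by simp; grind)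
    (by grind)

lemma Mx.close_even1 (h : Mx col c L v W) {r : ℕ} (hrL : 2 * r ≤ L)
    (hW : r + 5 ≤ W.card) : HasLooseCycle 4 (2 * r + 2) col (!c) := by
  obtain ⟨e, Q, A, w, w', he, heQ, hbig, hWQ, hA, hAc, hw, hw', -, -, hP⟩ :=
    h.start r (by omega) (by omega) ∅ (by simp)
  have h2 := Finset.card_sdiff_add_card_eq_card hA
  have hele := he.le
  have heW := h.dis e hele
  obtain ⟨u₁, u₂, u₃, u₄, hn, m1, m2, m3, m4⟩ := pick4 (W \ A) (by omega)
  have hU : ∀ u ∈ W \ A, u ∈ W ∧ u ∉ Q ∧ u ∉ A ∧ u ≠ w ∧ u ≠ w' ∧ u ≠ v e := by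
    intro u hu
    rw [Finset.mem_sdiff] at hu
    refine ⟨hu.1, hWQ u hu.1, hu.2, ?_, ?_, ?_⟩
    · rintro rfl; exact hu.2 hw
    · rintro rfl; exact hu.2 hw'
    · rintro rfl; exact heW hu.1
  have b1 := hU _ m1
  have b2 := hU _ m2
  have b3 := hU _ m3
  have b4 := hU _ m4
  have heA : v e ∉ A := fun hh => heW (hA hh)
  simp only [List.nodup_cons, List.mem_cons, List.not_mem_nil, or_false, not_or] at hn
  have E1 := h.endE he (hA hw') b1.1 b2.1 (by simp; grind)
  have E2 := h.endE he b3.1 b4.1 (hA hw) (by simp; grind)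
  have l1 := hP.snoc (a := u₁) (b := u₂) (z := v e)
    (by rw [← E1]; congr 1; ext z; simp; tauto) (by simp; tauto) (by simp; tauto) (by simp; tauto)
    (by tauto) (by tauto) (by tauto)
  exact l1.hasCycle (a := u₃) (b := u₄) E2 (by simp; grind) (by simp; grind) (by grind)

lemma Mx.aaww (h : Mx col c L v W) (hL : 1 ≤ L) {t : V}
    (ht : t ∈ Rs col c W {v (3 * L - 3), v (3 * L - 2), v (3 * L - 1)}) {p : ℕ}
    (hp : p = 3 * L - 2 ∨ p = 3 * L - 1) {a b : V} (ha : a ∈ W) (hb : b ∈ W) (hab : a ≠ b)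
    (hta : t ≠ a) (htb : t ≠ b) : col {v p, v (3 * L), a, b} = !c := by
  apply eq_not_of_ne
  intro he
  simp only [Rs, Finset.mem_filter] at ht
  obtain ⟨p', hp', hpp⟩ : ∃ p', (p' = 3 * L - 2 ∨ p' = 3 * L - 1) ∧ p ≠ p' := by
    rcases hp with rfl | rfl
    · exact ⟨3 * L - 1, by omega, by omega⟩
    · exact ⟨3 * L - 2, by omega, by omega⟩
  have e1 : col {v (3 * L - 3), v p', t, v p} = c := by
    rw [← ht.2]; congr 1; ext z
    rcases hp with rfl | rfl
    · have : p' = 3 * L - 1 := by omega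
      subst this; simp; tauto
    · have : p' = 3 * L - 2 := by omega
      subst this; simp; tauto
  have hpre := h.sq.pre (i := L - 1) (p := 3 * L - 3) (by omega) (Or.inl (by omega))
  have hni : ∀ z ∈ W, z ∉ (Finset.Icc 0 (3 * (L - 1))).image v := by
    intro z hz hz'
    obtain ⟨t, ht, rfl⟩ := Finset.mem_image.1 hz'
    rw [Finset.mem_Icc] at ht
    exact h.dis t (by omega) hz
  have hnv : ∀ q, 3 * L - 3 < q → q ≤ 3 * L → v q ∉ (Finset.Icc 0 (3 * (L - 1))).image v := by
    intro q hq hq'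
    rw [h.sq.mem_iff] <;> omega
  have vw : ∀ q ≤ 3 * L, ∀ w ∈ W, v q ≠ w := fun t ht w hw e => h.dis t ht (e ▸ hw)
  have d1 := vw p (by omega)
  have d2 := vw p' (by omega)
  have d3 := vw (3 * L) (by omega)
  have d4 := vw (3 * L - 3) (by omega)
  have c1 : v p ≠ v p' := h.sq.ne (by omega) (by omega) hpp
  have c2 : v p ≠ v (3 * L) := h.sq.ne (by omega) (by omega) (by omega)
  have c3 : v p' ≠ v (3 * L) := h.sq.ne (by omega) (by omega) (by omega)
  have c4 : v (3 * L - 3) ≠ v (3 * L) := h.sq.ne (by omega) (by omega) (by omega)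
  have l1 := hpre.snoc e1 (hnv _ (by omega) (by omega)) (hni _ ht.1) (hnv _ (by omega) (by omega))
    (d2 _ ht.1) c1.symm (d1 _ ht.1).symm
  have l2 := l1.snoc (a := v (3 * L)) (b := a) (z := b) he
    (by
      have := hnv (3 * L) (by omega) (by omega)
      rw [Finset.mem_union, not_or]
      refine ⟨this, ?_⟩
      simp only [Finset.mem_insert, Finset.mem_singleton]; grind)
    (by
      have := hni a ha
      rw [Finset.mem_union, not_or]
      refine ⟨this, ?_⟩
      simp only [Finset.mem_insert, Finset.mem_singleton]; grind)
    (by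
      have := hni b hb
      rw [Finset.mem_union, not_or]
      refine ⟨this, ?_⟩
      simp only [Finset.mem_insert, Finset.mem_singleton]; grind) (by grind) (by grind) hab
  rw [show L - 1 + 1 + 1 = L + 1 by omega] at l2
  exact h.np l2.hasPath

lemma Mx.close_even2 (h : Mx col c L v W) {r : ℕ} (hr : 1 ≤ r) (hrL : 2 * r + 2 ≤ L)
    (hW : r + 3 ≤ W.card) : HasLooseCycle 4 (2 * r + 2) col (!c) := by
  have vw : ∀ q ≤ 3 * L, ∀ w ∈ W, v q ≠ w := fun t ht w hw e => h.dis t ht (e ▸ hw)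
  have d0 := vw (3 * L - 3) (by omega)
  have d1 := vw (3 * L - 2) (by omega)
  have d2 := vw (3 * L - 1) (by omega)
  have d3 := vw (3 * L) (by omega)
  have c01 : v (3 * L - 3) ≠ v (3 * L - 2) := h.sq.ne (by omega) (by omega) (by omega)
  have c02 : v (3 * L - 3) ≠ v (3 * L - 1) := h.sq.ne (by omega) (by omega) (by omega)
  have c03 : v (3 * L - 3) ≠ v (3 * L) := h.sq.ne (by omega) (by omega) (by omega)
  have c12 : v (3 * L - 2) ≠ v (3 * L - 1) := h.sq.ne (by omega) (by omega) (by omega)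
  have c13 : v (3 * L - 2) ≠ v (3 * L) := h.sq.ne (by omega) (by omega) (by omega)
  have c23 : v (3 * L - 1) ≠ v (3 * L) := h.sq.ne (by omega) (by omega) (by omega)
  by_cases hR : (Rs col c W {v (3 * L - 3), v (3 * L - 2), v (3 * L - 1)}).card ≤ 1
  · obtain ⟨-, Q, A, w, w', -, -, hbig, hWQ, hA, hAc, hw, hw', hwR, hne, hP⟩ :=
      h.start r (by omega) (by omega) _ hR
    have h2 := Finset.card_sdiff_add_card_eq_card hA
    obtain ⟨u, u', huu, hu, hu'⟩ := pick2 (W \ A) (by omega)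
    rw [Finset.mem_sdiff] at hu hu'
    have E1 := Rs_notMem (hA hw') hwR
    have E2 := h.endE (p := 3 * L - 1) (Or.inr ⟨by omega, Or.inr rfl⟩) hu.1 hu'.1 (hA hw)
      (by simp; grind)
    have b0 := hbig (3 * L - 3) (by omega) (by omega)
    have b1 := hbig (3 * L - 2) (by omega) (by omega)
    have b2 := hbig (3 * L - 1) (by omega) (by omega)
    have l1 := hP.snoc E1 b0 b1 b2 c01 c02 c12
    have q1 := hWQ u hu.1
    have q2 := hWQ u' hu'.1
    exact l1.hasCycle E2 (by simp; grind) (by simp; grind) huu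
  · obtain ⟨-, Q, A, w, w', -, -, hbig, hWQ, hA, hAc, hw, hw', -, hne, hP⟩ :=
      h.start r (by omega) (by omega) ∅ (by simp)
    have h2 := Finset.card_sdiff_add_card_eq_card hA
    have hww := hne hr
    have key : ∃ u u' : V, u ≠ u' ∧ u ∈ W \ A ∧ u' ∈ W \ A ∧
        (∃ t ∈ Rs col c W {v (3 * L - 3), v (3 * L - 2), v (3 * L - 1)}, t ≠ w ∧ t ≠ u) ∧
        (∃ t ∈ Rs col c W {v (3 * L - 3), v (3 * L - 2), v (3 * L - 1)}, t ≠ w' ∧ t ≠ u') := by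
      obtain ⟨u, u', huu, hu, hu'⟩ := pick2 (W \ A) (by omega)
      obtain ⟨p, q, hpq, hp, hq⟩ := pick2 _ (by omega : 2 ≤ (Rs col c W {v (3 * L - 3), v (3 * L - 2), v (3 * L - 1)}).card)
      have n1 : u ≠ w := by rintro rfl; simp [hw] at hu
      have n2 : u' ≠ w := by rintro rfl; simp [hw] at hu'
      have n3 : u ≠ w' := by rintro rfl; simp [hw'] at hu
      have n4 : u' ≠ w' := by rintro rfl; simp [hw'] at hu'
      by_cases z1 : (p ≠ w ∧ p ≠ u) ∨ (q ≠ w ∧ q ≠ u)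
      · by_cases z2 : (p ≠ w' ∧ p ≠ u') ∨ (q ≠ w' ∧ q ≠ u')
        · exact ⟨u, u', huu, hu, hu', by grind, by grind⟩
        · refine ⟨u', u, huu.symm, hu', hu, ?_, ?_⟩
          · have : (p ≠ w ∧ p ≠ u') ∨ (q ≠ w ∧ q ≠ u') := by grind
            grind
          · have : (p ≠ w' ∧ p ≠ u) ∨ (q ≠ w' ∧ q ≠ u) := by grind
            grind
      · refine ⟨u', u, huu.symm, hu', hu, ?_, ?_⟩
        · have : (p ≠ w ∧ p ≠ u') ∨ (q ≠ w ∧ q ≠ u') := by grind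
          grind
        · have : (p ≠ w' ∧ p ≠ u) ∨ (q ≠ w' ∧ q ≠ u) := by grind
          grind
    obtain ⟨u, u', huu, hu, hu', ⟨t, ht, t1, t2⟩, ⟨t', ht', t3, t4⟩⟩ := key
    rw [Finset.mem_sdiff] at hu hu'
    have nu : u ≠ w := by rintro rfl; exact hu.2 hw
    have nu' : u' ≠ w' := by rintro rfl; exact hu'.2 hw'
    have E1 := h.aaww (by omega) ht' (p := 3 * L - 1) (Or.inr rfl) (hA hw') hu'.1 nu'.symm t3 t4
    have E2 := h.aaww (by omega) ht (p := 3 * L - 2) (Or.inl rfl) (hA hw) hu.1 nu.symm t1 t2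
    have b1 := hbig (3 * L - 2) (by omega) (by omega)
    have b2 := hbig (3 * L - 1) (by omega) (by omega)
    have b3 := hbig (3 * L) (by omega) (by omega)
    have q1 := hWQ u hu.1
    have q2 := hWQ u' hu'.1
    have l1 := hP.snoc (a := u') (b := v (3 * L - 1)) (z := v (3 * L))
      (by rw [← E1]; congr 1; ext z; simp; tauto) (by simp; tauto) b2 b3 (d2 _ hu'.1).symm
      (d3 _ hu'.1).symm c23
    exact l1.hasCycle (a := v (3 * L - 2)) (b := u)
      (by rw [← E2]; congr 1; ext z; simp; tauto) (by simp; grind) (by simp; grind) (d1 _ hu.1)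

lemma Ctx.odd (h : Ctx col c L v W) {s : ℕ} (hL : L = 2 * s + 1) (hs : 1 ≤ s)
    (hW : s + 5 ≤ W.card) : HasLoosePath 4 (2 * s + 1) col (!c) := by
  obtain ⟨y, Q, A, w, w', hy, hQ, hA, hAc, hw, hw', -, hne, hP⟩ :=
    h.chain s (by omega) (by omega) ∅ (by simp)
  have hyle := hy.le
  have hww := hne hs
  obtain ⟨u1, u2, u3, u4, hn, h1, h2, h3, -⟩ := pick4 (W \ A) (by
    rw [Finset.card_sdiff_of_subset hA]; omega)
  simp only [Finset.mem_sdiff] at h1 h2 h3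
  simp at hn
  have hWQ : ∀ z ∈ W, z ∉ Q := by
    intro z hz hzQ
    obtain ⟨t, ht, rfl, _⟩ := hQ _ hzQ
    exact h.dis t (by omega) hz
  have hyW : v y ∉ W := h.dis y (by omega)
  have hlW : v (3 * L) ∉ W := h.dis _ le_rfl
  have hyQ : v y ∉ Q := by
    intro hm
    obtain ⟨t, ht, e', hty⟩ := hQ _ hm
    exact hty (h.sq.inj y t (by omega) (by omega) e').symm
  have hlQ : v (3 * L) ∉ Q := by
    intro hm
    obtain ⟨t, ht, e', hty⟩ := hQ _ hm
    have := h.sq.inj _ t (by omega) (by omega) e'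
    omega
  have hyl : v y ≠ v (3 * L) := h.sq.ne (by omega) (by omega) (by omega)
  have nW : ∀ {a b : V}, a ∉ W → b ∈ W → a ≠ b := fun ha hb e => ha (e ▸ hb)
  have nA : ∀ {a b : V}, a ∉ A → b ∈ A → a ≠ b := fun ha hb e => ha (e ▸ hb)
  by_cases c1 : col {v y, u1, u2, w} = c
  · by_cases c2 : col {w', u2, u3, v (3 * L)} = c
    · exfalso
      have p2 : LP col c 1 u2 (v (3 * L)) {u2, u3, w', v (3 * L)} := by
        apply LP.single
        · rw [← c2]; congr 1; ext z; simp; tauto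
        · simp
          exact ⟨⟨by tauto, nA h2.2 hw', (nW hlW h2.1).symm⟩,
            ⟨nA h3.2 hw', (nW hlW h3.1).symm⟩, (nW hlW (hA hw')).symm⟩
      have p1 : LP col c (1 + 1) (v y) (v (3 * L))
          (insert (v y) (insert u1 (insert w {u2, u3, w', v (3 * L)}))) := by
        refine LP.cons ?_ p2 ?_ ?_ ?_ (nW hyW h1.1) (nW hyW (hA hw)) (nA h1.2 hw)
        · rw [← c1]; congr 1; ext z; simp; tauto
        · simp only [Finset.mem_insert, Finset.mem_singleton, not_or]
          exact ⟨nW hyW h2.1, nW hyW h3.1, nW hyW (hA hw'), hyl⟩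
        · simp only [Finset.mem_insert, Finset.mem_singleton, not_or]
          exact ⟨by tauto, by tauto, nA h1.2 hw', (nW hlW h1.1).symm⟩
        · simp only [Finset.mem_insert, Finset.mem_singleton, not_or]
          exact ⟨(nA h2.2 hw).symm, (nA h3.2 hw).symm, hww, (nW hlW (hA hw)).symm⟩
      subst hL
      refine h.glue (i := 2 * s) (j := 1) le_rfl le_rfl hy p1 ?_
      intro z hz
      simp only [Finset.mem_insert, Finset.mem_singleton] at hz
      rcases hz with e | e | e | e | e | e | e
      · exact Or.inl e
      · exact Or.inr (Or.inr (e ▸ h1.1))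
      · exact Or.inr (Or.inr (e ▸ hA hw))
      · exact Or.inr (Or.inr (e ▸ h2.1))
      · exact Or.inr (Or.inr (e ▸ h3.1))
      · exact Or.inr (Or.inr (e ▸ hA hw'))
      · exact Or.inr (Or.inl ⟨_, by omega, le_rfl, e⟩)
    · refine (hP.snoc (eq_not_of_ne c2) ?_ ?_ ?_ (by tauto) (nW hlW h2.1).symm
        (nW hlW h3.1).symm).hasPath
      · simp [hWQ _ h2.1, h2.2]
      · simp [hWQ _ h3.1, h3.2]
      · simp [hlQ]; exact fun hh => hlW (hA hh)
  · refine (LP.cons (eq_not_of_ne c1) hP ?_ ?_ ?_ (nW hyW h1.1) (nW hyW h2.1) (by tauto)).hasPath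
    · simp [hyQ]; exact fun hh => hyW (hA hh)
    · simp [hWQ _ h1.1, h1.2]
    · simp [hWQ _ h2.1, h2.2]

lemma cyc_ctx [Fintype V] (hc : HasLooseCycle 4 (L + 1) col c)
    (hn : ¬ HasLooseCycle 4 (L + 2) col c) :
    ∃ v W, Ctx col c L v W ∧ Fintype.card V ≤ 3 * (L + 1) + W.card := by
  obtain ⟨f, hf, he⟩ := hc
  have inj : ∀ i j, i < 3 * (L + 1) → j < 3 * (L + 1) → f i = f j → i = j := by
    intro i j hi hj e
    exact hf (by simp; omega) (by simp; omega) e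
  have hlast := he L (by omega)
  rw [img4] at hlast
  have e0 : (L * (4 - 1) + 0) % ((L + 1) * (4 - 1)) = 3 * L := by
    rw [Nat.mod_eq_of_lt] <;> omega
  have e1 : (L * (4 - 1) + 1) % ((L + 1) * (4 - 1)) = 3 * L + 1 := by
    rw [Nat.mod_eq_of_lt] <;> omega
  have e2 : (L * (4 - 1) + 2) % ((L + 1) * (4 - 1)) = 3 * L + 2 := by
    rw [Nat.mod_eq_of_lt] <;> omega
  have e3 : (L * (4 - 1) + 3) % ((L + 1) * (4 - 1)) = 0 := by
    rw [show L * (4 - 1) + 3 = (L + 1) * (4 - 1) by omega, Nat.mod_self]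
  rw [e0, e1, e2, e3] at hlast
  refine ⟨f, Finset.univ \ (Finset.range (3 * (L + 1))).image f, ⟨⟨?_, ?_⟩, ?_, ?_⟩, ?_⟩
  · intro i j hi hj e
    exact inj i j (by omega) (by omega) e
  · intro i hi
    have := he i (by omega)
    rw [img4] at this
    rw [Nat.mod_eq_of_lt (by omega), Nat.mod_eq_of_lt (by omega), Nat.mod_eq_of_lt (by omega),
      Nat.mod_eq_of_lt (by omega)] at this
    rw [show i * (4 - 1) = 3 * i by omega] at this
    exact this
  · intro i hi hm
    simp only [Finset.mem_sdiff, Finset.mem_image, Finset.mem_range] at hm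
    exact hm.2 ⟨i, by omega, rfl⟩
  · intro S hS hsub
    have key : ∀ t, 3 * L < t → t < 3 * (L + 1) → f t ∉ S := by
      intro t h1 h2 hm
      have := hsub hm
      simp only [Finset.mem_union, Finset.mem_sdiff, Finset.mem_image, Finset.mem_range,
        Finset.mem_Icc] at this
      rcases this with ⟨q, hq, e⟩ | ⟨_, hh⟩
      · have := inj q t (by omega) (by omega) e
        omega
      · exact hh ⟨t, h2, rfl⟩
    refine hn (hS.hasCycle hlast (key _ (by omega) (by omega)) (key _ (by omega) (by omega)) ?_)
    intro e
    have := inj _ _ (by omega) (by omega) e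
    omega
  · have h1 := Finset.card_image_le (s := Finset.range (3 * (L + 1))) (f := f)
    rw [Finset.card_range] at h1
    have h2 := Finset.le_card_sdiff ((Finset.range (3 * (L + 1))).image f) Finset.univ
    rw [Finset.card_univ] at h2
    omega

lemma sub_path {n k : ℕ} (h : HasLoosePath 4 n col c) (hk : k ≤ n) : HasLoosePath 4 k col c := by
  obtain ⟨f, h1, h2⟩ := h
  refine ⟨f, h1.mono ?_, fun i hi => h2 i (by omega)⟩
  intro x hx
  simp at hx ⊢
  omega

lemma longest {n k : ℕ} [Fintype V] (hk : HasLoosePath 4 k col c)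
    (hn : ¬ HasLoosePath 4 n col c) :
    ∃ l v W, k ≤ l ∧ l < n ∧ Mx col c l v W ∧ Fintype.card V ≤ 3 * l + 1 + W.card := by
  classical
  have hkn : k < n := by
    by_contra hh
    exact hn (sub_path hk (by omega))
  let l := Nat.findGreatest (fun t => HasLoosePath 4 t col c) n
  have hl : HasLoosePath 4 l col c := Nat.findGreatest_spec (P := fun t => HasLoosePath 4 t col c) hkn.le hk
  have hkl : k ≤ l := Nat.le_findGreatest hkn.le hk
  have hln : l < n := by
    by_contra hh
    exact hn (sub_path hl (by omega))
  have hnl : ¬ HasLoosePath 4 (l + 1) col c := fun hh => by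
    have := Nat.le_findGreatest (P := fun t => HasLoosePath 4 t col c) (n := n) (by omega) hh
    change l + 1 ≤ l at this
    omega
  obtain ⟨v, hv⟩ := sq_of_path hl
  refine ⟨l, v, Finset.univ \ (Finset.range (3 * l + 1)).image v, hkl, hln, ⟨hv, ?_, hnl⟩, ?_⟩
  · intro i hi hm
    simp only [Finset.mem_sdiff, Finset.mem_image, Finset.mem_range] at hm
    exact hm.2 ⟨i, by omega, rfl⟩
  · have h1 := Finset.card_image_le (s := Finset.range (3 * l + 1)) (f := v)
    rw [Finset.card_range] at h1
    have h2 := Finset.le_card_sdiff ((Finset.range (3 * l + 1)).image v) Finset.univ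
    rw [Finset.card_univ] at h2
    omega

lemma finish [Fintype V] {n m k : ℕ} (hm : 3 ≤ m) (h : m + 1 ≤ n ∨ (n = m ∧ Odd m))
    (hN : 3 * n + (m + 1) / 2 ≤ Fintype.card V) (hk : HasLoosePath 4 k col true)
    (hkm : m ≤ k + 2) (hn : ¬ HasLoosePath 4 n col true) : HasLooseCycle 4 m col false := by
  obtain ⟨l, v, W, h1, h2, hM, h3⟩ := longest hk hn
  rcases Nat.even_or_odd' m with ⟨r, rfl | rfl⟩
  · have h' : 2 * r + 1 ≤ n := by
      rcases h with h | ⟨_, h⟩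
      · exact h
      · exact absurd h (by simp)
    obtain ⟨r, rfl⟩ : ∃ k, r = k + 1 := ⟨r - 1, by omega⟩
    by_cases hl : 2 * r + 2 ≤ l
    · exact hM.close_even2 (r := r) (by omega) hl (by omega)
    · exact hM.close_even1 (r := r) (by omega) (by omega)
  · by_cases hl : 2 * r ≤ l
    · exact hM.close_odd1 (r := r) (by omega) hl (by omega)
    · obtain ⟨s, rfl⟩ : ∃ k, r = k + 1 := ⟨r - 1, by omega⟩
      exact hM.close_odd2 (s := s) (by omega) (by omega)

lemma base3 [Fintype V] (hN : 9 ≤ Fintype.card V) (hn : ¬ HasLooseCycle 4 3 col false) :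
    HasLoosePath 4 1 col true := by
  by_contra hp
  obtain ⟨l, h1, h2, -⟩ := pick (Finset.univ : Finset V) 9 (by rwa [Finset.card_univ])
  have hl : ∀ i (hi : i < 9), i < l.length := fun i hi => by omega
  have hV : Nonempty V := ⟨l[0]'(hl 0 (by omega))⟩
  let f : ℕ → V := fun i => if hi : i < l.length then l[i] else Classical.choice hV
  have finj : ∀ i j, i < 9 → j < 9 → f i = f j → i = j := by
    intro i j hi hj e
    simp only [f, hl i hi, hl j hj, dif_pos] at e
    exact (List.Nodup.getElem_inj_iff h2).1 e
  refine hn ⟨f, ?_, ?_⟩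
  · intro i hi j hj e
    simp at hi hj
    exact finj i j (by omega) (by omega) e
  · intro i hi
    by_contra hc
    refine hp ⟨fun j => f ((i * (4 - 1) + j) % (3 * (4 - 1))), ?_, ?_⟩
    · intro a ha b hb e
      simp at ha hb
      have := finj _ _ (Nat.mod_lt _ (by omega)) (Nat.mod_lt _ (by omega)) e
      omega
    · intro t ht
      obtain rfl : t = 0 := by omega
      simpa using hc

lemma upper [Fintype V] (m : ℕ) (hm : 3 ≤ m) : ∀ n, (m + 1 ≤ n ∨ (n = m ∧ Odd m)) →
    3 * n + (m + 1) / 2 ≤ Fintype.card V → ¬ HasLoosePath 4 n col true →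
    HasLooseCycle 4 m col false := by
  induction m, hm using Nat.le_induction with
  | base =>
    intro n h hN hn
    by_contra hc
    exact hc (finish le_rfl h hN (base3 (by omega) hc) (by omega) hn)
  | succ m hm ih =>
    intro n h hN hn
    have hC := ih n (Or.inl (by omega)) (by omega) hn
    by_contra hc
    refine hc (finish (by omega) h hN (k := m - 1) ?_ (by omega) hn)
    obtain ⟨L, rfl⟩ : ∃ L, m = L + 1 := ⟨m - 1, by omega⟩
    obtain ⟨v, W, hX, hW⟩ := cyc_ctx hC hc
    rcases Nat.even_or_odd' L with ⟨s, rfl | rfl⟩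
    · obtain ⟨y, Q, A, w, w', -, -, -, -, -, -, -, -, hP⟩ :=
        hX.chain s (by omega) (by omega) ∅ (by simp)
      exact hP.hasPath
    · exact hX.odd (s := s) rfl (by omega) (by omega)

lemma lower (n m N : ℕ) (hn : 1 ≤ n) (hm : 1 ≤ m) (hN : N < 3 * n + (m + 1) / 2) :
    ∃ col : Finset (Fin N) → Bool,
      ¬ HasLoosePath 4 n col true ∧ ¬ HasLooseCycle 4 m col false := by
  refine ⟨fun T => decide (∀ x ∈ T, x.val < 3 * n), ?_, ?_⟩
  · rintro ⟨f, hf, he⟩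
    have hlt : ∀ p < 3 * n + 1, (f p).val < 3 * n := by
      intro p hp
      by_cases hp3 : p = 3 * n
      · have := he (n - 1) (by omega)
        simp only [decide_eq_true_eq, Finset.mem_image, Finset.mem_range] at this
        exact this _ ⟨3, by omega, by congr 1; omega⟩
      · have := he (p / 3) (by omega)
        simp only [decide_eq_true_eq, Finset.mem_image, Finset.mem_range] at this
        exact this _ ⟨p % 3, by omega, by congr 1; omega⟩
    have := Finset.card_le_card_of_injOn (s := Finset.range (3 * n + 1))
      (t := Finset.range (3 * n)) (fun p => (f p).val) (by
        intro p hp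
        simp at hp ⊢
        exact hlt p (by omega)) (by
        intro p hp q hq e
        simp at hp hq
        exact hf (by simp; omega) (by simp; omega) (Fin.ext e))
    simp at this
  · rintro ⟨f, hf, he⟩
    have hex : ∀ i, ∃ j, i < m → j < 3 * m ∧ 3 * n ≤ (f j).val ∧
        ∃ t < 4, j = (3 * i + t) % (3 * m) := by
      intro i
      by_cases hi : i < m
      · have := he i hi
        simp only [decide_eq_false_iff_not, Finset.mem_image, Finset.mem_range, not_forall] at this
        obtain ⟨x, ⟨t, ht, e⟩, hx⟩ := this
        refine ⟨(3 * i + t) % (3 * m), fun _ => ⟨Nat.mod_lt _ (by omega), ?_, t, ht, rfl⟩⟩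
        rw [show 3 * i = i * (4 - 1) by omega, show 3 * m = m * (4 - 1) by omega, e]
        omega
      · exact ⟨0, fun h => absurd h hi⟩
    choose g hg using hex
    have hcard : (Finset.range m).card ≤ 2 * (Finset.Ico (3 * n) N).card := by
      refine Finset.card_le_mul_card_image_of_maps_to (f := fun i => (f (g i)).val) ?_ 2 ?_
      · intro i hi
        have := (hg i (by simpa using hi)).2.1
        simp only [Finset.mem_Ico]
        exact ⟨this, (f (g i)).isLt⟩
      · intro b _
        by_contra hlt
        obtain ⟨i, hi, j, hj, k, hk, hij, hik, hjk⟩ := Finset.two_lt_card.1 (not_le.1 hlt)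
        simp only [Finset.mem_filter, Finset.mem_range] at hi hj hk
        have key : ∀ i < m, g i = 3 * i ∨ g i = 3 * i + 1 ∨ g i = 3 * i + 2 ∨
            g i = 3 * i + 3 ∨ (g i = 0 ∧ i = m - 1) := by
          intro i hi
          obtain ⟨-, -, t, ht, e⟩ := hg i hi
          by_cases hlt : 3 * i + t < 3 * m
          · rw [Nat.mod_eq_of_lt hlt] at e
            omega
          · rw [show 3 * i + t = 3 * m by omega, Nat.mod_self] at e
            omega
        have l1 := (hg i hi.1).1
        have l2 := (hg j hj.1).1
        have l3 := (hg k hk.1).1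
        have q1 : g i = g j := hf (by simp; omega) (by simp; omega)
          (Fin.ext (hi.2.trans hj.2.symm))
        have q2 : g i = g k := hf (by simp; omega) (by simp; omega)
          (Fin.ext (hi.2.trans hk.2.symm))
        have k1 := key i hi.1
        have k2 := key j hj.1
        have k3 := key k hk.1
        omega
    simp at hcard
    omega

end R4

/-- If n ≥ m + 1 ≥ 4, or n = m ≥ 3 with n odd, then R(P⁴ₙ, C⁴ₘ) = 3n + ⌊(m+1)/2⌋. -/
theorem ramsey_P4n_C4m (n m : ℕ)
    (h : (4 ≤ m + 1 ∧ m + 1 ≤ n) ∨ (n = m ∧ 3 ≤ n ∧ Odd n)) :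
    RamseyPC 4 n m = 3 * n + (m + 1) / 2 := by
  have hm : 3 ≤ m := by omega
  have hn : 3 ≤ n := by omega
  have h' : m + 1 ≤ n ∨ (n = m ∧ Odd m) := by
    rcases h with h | ⟨rfl, _, ho⟩
    · exact Or.inl h.2
    · exact Or.inr ⟨rfl, ho⟩
  have hmem : (3 * n + (m + 1) / 2) ∈ {N | 0 < N ∧ ∀ col : Finset (Fin N) → Bool,
      HasLoosePath 4 n col true ∨ HasLooseCycle 4 m col false} := by
    refine ⟨by omega, fun col => ?_⟩
    by_cases hp : HasLoosePath 4 n col true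
    · exact Or.inl hp
    · exact Or.inr (R4.upper m hm n h' (by simp) hp)
  unfold RamseyPC
  apply le_antisymm
  · exact Nat.sInf_le hmem
  · refine le_csInf ⟨_, hmem⟩ ?_
    rintro N ⟨_, hN⟩
    by_contra hlt
    obtain ⟨col, h1, h2⟩ := R4.lower n m N (by omega) (by omega) (not_le.1 hlt)
    rcases hN col with h3 | h3
    · exact h1 h3
    · exact h2 h3
end
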